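/- Let χ^ν be a component of χ^α ⊗ χ^β (i.e., k(α,β,ν) > 0). Then χ^ν is a maximal component (k(α,β,γ) = 0 for every partition γ strictly dominating ν) if and only if k(α,β,ν) = lr(α,β;ν). -/

import Mathlib

open Finset Equiv
open scoped Classical

noncomputable section

/-- Value at `g` of the permutation character of `S_n` induced from the trivial character of
the Young subgroup of the composition `c`: the number of colorings of `Fin n` with fiber
sizes given by `c` that are fixed by `g`. -/
def permChar (n : ℕ) (c : ℕ → ℕ) (g : Perm (Fin n)) : ℚ :=
  Nat.card {f : Fin n → ℕ // (∀ k, Nat.card {x : Fin n // f x = k} = c k) ∧ ∀ x, f (g x) = f x}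

/-- Inner product of class functions (real-valued characters) of `S_n`. -/
def innerChar (n : ℕ) (χ ψ : Perm (Fin n) → ℚ) : ℚ :=
  (∑ g : Perm (Fin n), χ g * ψ g) / (n.factorial : ℚ)

/-- The trivial character `χ^{(n)}` of `S_n`. -/
def trivChar (n : ℕ) : Perm (Fin n) → ℚ := fun _ => 1

/-- The sign character `χ^{(1^n)}` of `S_n`. -/
def signChar (n : ℕ) : Perm (Fin n) → ℚ := fun g => ((Perm.sign g : ℤ) : ℚ)

/-- Permutation character for an integer vector: zero if some entry is negative. -/
def permCharZ (n : ℕ) (c : ℕ → ℤ) (g : Perm (Fin n)) : ℚ :=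
  if ∀ k, 0 ≤ c k then permChar n (fun k => (c k).toNat) g else 0

/-- The irreducible character `χ^a` of `S_n` indexed by the partition `a`, given by the
Jacobi–Trudi determinantal formula `χ^a = ∑_σ sgn(σ) φ^{(a_i - i + σ(i))_i}`. -/
def irrChar (n : ℕ) (a : ℕ → ℕ) (g : Perm (Fin n)) : ℚ :=
  ∑ σ : Perm (Fin n), ((Perm.sign σ : ℤ) : ℚ) *
    permCharZ n (fun i => if h : i < n then (a i : ℤ) - i + ((σ ⟨i, h⟩ : Fin n) : ℕ) else 0) g

/-- Kronecker coefficient `k(a,b,c) = ⟨χ^a ⊗ χ^b, χ^c⟩`. -/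
def kron (n : ℕ) (a b c : ℕ → ℕ) : ℚ :=
  innerChar n (fun g => irrChar n a g * irrChar n b g) (irrChar n c)

/-- Extend a vector indexed by `Fin p` to `ℕ` by zeros. -/
def extc {p : ℕ} (l : Fin p → ℕ) : ℕ → ℕ := fun i => if h : i < p then l ⟨i, h⟩ else 0

/-- Dominance order: `a ⊵ b`. -/
def Dominates (a b : ℕ → ℕ) : Prop :=
  ∀ k, ∑ i ∈ Finset.range k, b i ≤ ∑ i ∈ Finset.range k, a i

/-- Conjugate (transpose) of a partition with at most `n` parts. -/
def conjFun (n : ℕ) (a : ℕ → ℕ) : ℕ → ℕ :=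
  fun j => ((Finset.range n).filter (fun i => j < a i)).card

/-- `a` is a partition of `n` (weakly decreasing, supported on the first `n` parts). -/
def IsPartitionFun (n : ℕ) (a : ℕ → ℕ) : Prop :=
  (∀ i j, i ≤ j → a j ≤ a i) ∧ (∀ i, n ≤ i → a i = 0) ∧ ∑ i ∈ Finset.range n, a i = n

/-- The weakly decreasing sequence of parts of `P : Nat.Partition n`. -/
def pf {n : ℕ} (P : n.Partition) : ℕ → ℕ :=
  fun i => ((P.parts.sort (· ≤ ·)).reverse).getD i 0

/-- The parts of `P : Nat.Partition n` as a vector of length `n`. -/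
def pfin {n : ℕ} (P : n.Partition) : Fin n → ℕ := fun k => pf P k

/-- Number of cells of the skew shape `a/b` where the filling `T` has entry `k`. -/
def skewContent (a b : ℕ → ℕ) (T : ℕ → ℕ → ℕ) (k : ℕ) : ℕ :=
  Nat.card {p : ℕ × ℕ // b p.1 ≤ p.2 ∧ p.2 < a p.1 ∧ T p.1 p.2 = k}

/-- Number of cells of the skew shape `a/b`. -/
def skewSize (a b : ℕ → ℕ) : ℕ :=
  Nat.card {p : ℕ × ℕ // b p.1 ≤ p.2 ∧ p.2 < a p.1}

/-- `T` is a semistandard filling of the shape `a` (zero outside, rows weakly increasing,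
columns strictly increasing). -/
def IsSSYT (a : ℕ → ℕ) (T : ℕ → ℕ → ℕ) : Prop :=
  (∀ i j, a i ≤ j → T i j = 0) ∧
  (∀ i j₁ j₂, j₁ ≤ j₂ → j₂ < a i → T i j₁ ≤ T i j₂) ∧
  (∀ i₁ i₂ j, i₁ < i₂ → j < a i₂ → T i₁ j < T i₂ j)

/-- The Kostka number: the number of semistandard Young tableaux of shape `a`
and content `c`. -/
def kostka (a c : ℕ → ℕ) : ℕ :=
  Nat.card {T : ℕ → ℕ → ℕ // IsSSYT a T ∧ ∀ k, skewContent a (fun _ => 0) T k = c k}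

/-- Number of entries equal to `k` in the prefix of the (right-to-left, top-to-bottom)
reading word of `T` ending at position `(i,j)`. -/
def lrCount (a b : ℕ → ℕ) (T : ℕ → ℕ → ℕ) (i j k : ℕ) : ℕ :=
  Nat.card {p : ℕ × ℕ //
    (p.1 < i ∨ (p.1 = i ∧ j ≤ p.2)) ∧ b p.1 ≤ p.2 ∧ p.2 < a p.1 ∧ T p.1 p.2 = k}

/-- `T` is a Littlewood–Richardson skew tableau of shape `a/b`: semistandard and its
reverse reading word is a lattice word. -/
def IsLR (a b : ℕ → ℕ) (T : ℕ → ℕ → ℕ) : Prop :=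
  (∀ i j, ¬(b i ≤ j ∧ j < a i) → T i j = 0) ∧
  (∀ i j₁ j₂, b i ≤ j₁ → j₁ ≤ j₂ → j₂ < a i → T i j₁ ≤ T i j₂) ∧
  (∀ i₁ i₂ j, i₁ < i₂ → b i₁ ≤ j → j < a i₁ → b i₂ ≤ j → j < a i₂ → T i₁ j < T i₂ j) ∧
  (∀ i j k, lrCount a b T i j (k + 1) ≤ lrCount a b T i j k)

/-- A Littlewood–Richardson multitableau of shape `α` with `r` parts: a chain of
partitions `0 = α(0) ⊆ α(1) ⊆ ⋯ ⊆ α(r) = α` together with Littlewood–Richardson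
fillings of the successive skew shapes. -/
structure LRMultiF (r : ℕ) (α : ℕ → ℕ) where
  chain : Fin (r + 1) → ℕ → ℕ
  antitone : ∀ k i j, i ≤ j → chain k j ≤ chain k i
  zero : ∀ i, chain 0 i = 0
  last : ∀ i, chain (Fin.last r) i = α i
  mono : ∀ (k : Fin r) (i : ℕ), chain k.castSucc i ≤ chain k.succ i
  T : Fin r → ℕ → ℕ → ℕ
  lr : ∀ k : Fin r, IsLR (chain k.succ) (chain k.castSucc) (T k)

/-- Content of the `k`-th tableau of a Littlewood–Richardson multitableau. -/
def LRMultiF.cont {r : ℕ} {α : ℕ → ℕ} (M : LRMultiF r α) (k : Fin r) : ℕ → ℕ :=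
  skewContent (M.chain k.succ) (M.chain k.castSucc) (M.T k)

/-- Size of the `k`-th tableau of a Littlewood–Richardson multitableau. -/
def LRMultiF.size {r : ℕ} {α : ℕ → ℕ} (M : LRMultiF r α) (k : Fin r) : ℕ :=
  skewSize (M.chain k.succ) (M.chain k.castSucc)

/-- `LR(α,β;ν)`: pairs of Littlewood–Richardson multitableaux of shapes `α`, `β`,
type `ν`, with equal contents. -/
def LRPairs (r : ℕ) (α β : ℕ → ℕ) (ν : Fin r → ℕ) :=
  {TS : LRMultiF r α × LRMultiF r β //
    (∀ k, TS.1.size k = ν k) ∧ (∀ k, TS.2.size k = ν k) ∧ ∀ k, TS.1.cont k = TS.2.cont k}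

/-- `LR*(α,β;ν)`: pairs of Littlewood–Richardson multitableaux of shapes `α`, `β`,
type `ν`, with termwise conjugate contents. -/
def LRPairsStar (n r : ℕ) (α β : ℕ → ℕ) (ν : Fin r → ℕ) :=
  {TS : LRMultiF r α × LRMultiF r β //
    (∀ k, TS.1.size k = ν k) ∧ (∀ k, TS.2.size k = ν k) ∧
      ∀ k m, TS.2.cont k m = conjFun n (TS.1.cont k) m}

/-- `lr(α,β;ν)`. -/
def lrNum (r : ℕ) (α β : ℕ → ℕ) (ν : Fin r → ℕ) : ℕ := Nat.card (LRPairs r α β ν)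

/-- `lr*(α,β;ν)`. -/
def lrStarNum (n r : ℕ) (α β : ℕ → ℕ) (ν : Fin r → ℕ) : ℕ :=
  Nat.card (LRPairsStar n r α β ν)

/-- A semistandard Young tableau (of arbitrary partition shape). -/
structure SSYTP where
  shape : ℕ → ℕ
  T : ℕ → ℕ → ℕ
  antitone : ∀ i j, i ≤ j → shape j ≤ shape i
  finite : ∃ N, ∀ i, N ≤ i → shape i = 0
  ssyt : IsSSYT shape T

/-- Content of a semistandard Young tableau. -/
def SSYTP.cont (P : SSYTP) : ℕ → ℕ := skewContent P.shape (fun _ => 0) P.T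

/-- The multiset of entries of a matrix. -/
def entriesM {p q : ℕ} (A : Fin p → Fin q → ℕ) : Multiset ℕ :=
  (Finset.univ : Finset (Fin p × Fin q)).val.map (fun ij => A ij.1 ij.2)

/-- The π-sequence of `A` is the partition `ν` (the weakly decreasing rearrangement of
the entries of `A` is `ν`). -/
def HasPiSeq {p q : ℕ} (A : Fin p → Fin q → ℕ) {n : ℕ} (ν : n.Partition) : Prop :=
  (entriesM A).filter (· ≠ 0) = ν.parts

end

namespace KroneckerLR

noncomputable section

section

section Characters

variable {G : Type} [Group G]

/-- `f` is the character of a finite-dimensional rational representation of `G`. -/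
def IsChar (f : G → ℚ) : Prop :=
  ∃ (V : Type) (_ : AddCommGroup V) (_ : Module ℚ V) (_ : FiniteDimensional ℚ V)
    (ρ : Representation ℚ G V), ρ.character = f

theorem isChar_character {V : Type} [AddCommGroup V] [Module ℚ V] [FiniteDimensional ℚ V]
    (ρ : Representation ℚ G V) : IsChar ρ.character :=
  ⟨V, _, _, inferInstance, ρ, rfl⟩

theorem IsChar.mul {f h : G → ℚ} (hf : IsChar f) (hh : IsChar h) : IsChar (f * h) := by
  obtain ⟨V, _, _, _, ρ, rfl⟩ := hf
  obtain ⟨W, _, _, _, σ, rfl⟩ := hh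
  rw [← Representation.char_tensor]
  exact isChar_character _

theorem character_prod {V W : Type} [AddCommGroup V] [Module ℚ V] [FiniteDimensional ℚ V]
    [AddCommGroup W] [Module ℚ W] [FiniteDimensional ℚ W]
    (ρ : Representation ℚ G V) (σ : Representation ℚ G W) :
    (ρ.prod σ).character = ρ.character + σ.character := by
  ext g
  exact LinearMap.trace_prodMap' _ _

theorem IsChar.add {f h : G → ℚ} (hf : IsChar f) (hh : IsChar h) : IsChar (f + h) := by
  obtain ⟨V, _, _, _, ρ, rfl⟩ := hf
  obtain ⟨W, _, _, _, σ, rfl⟩ := hh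
  rw [← character_prod]
  exact isChar_character _

theorem isChar_zero : IsChar (0 : G → ℚ) := by
  refine ⟨Fin 0 → ℚ, _, _, inferInstance, 1, ?_⟩
  ext g
  rw [Representation.character]
  have : ((1 : Representation ℚ G (Fin 0 → ℚ)) g) = 0 := Subsingleton.elim _ _
  rw [this, map_zero]
  rfl

theorem IsChar.sum {ι : Type*} (s : Finset ι) (f : ι → G → ℚ) (hf : ∀ i ∈ s, IsChar (f i)) :
    IsChar (∑ i ∈ s, f i) :=
  Finset.sum_induction f IsChar (fun _ _ => IsChar.add) isChar_zero hf

/-- The permutation character of a finite `G`-set. -/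
theorem isChar_perm {X : Type} [Fintype X] [MulAction G X] :
    IsChar (fun g : G => (Nat.card {x : X // g • x = x} : ℚ)) := by
  let ρ : Representation ℚ G (X → ℚ) :=
    { toFun := fun g => LinearMap.funLeft ℚ ℚ (fun x : X => g⁻¹ • x)
      map_one' := by ext; simp
      map_mul' := by intro a b; ext; simp [mul_smul] }
  refine ⟨X → ℚ, _, _, inferInstance, ρ, ?_⟩
  ext g
  rw [Representation.character, LinearMap.trace_eq_matrix_trace ℚ (Pi.basisFun ℚ X), Matrix.trace]
  have : ∀ x : X, (LinearMap.toMatrix (Pi.basisFun ℚ X) (Pi.basisFun ℚ X) (ρ g)).diag x =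
      if g • x = x then 1 else 0 := by
    intro x
    rw [Matrix.diag_apply, LinearMap.toMatrix_apply]
    simp only [Pi.basisFun_apply, Pi.basisFun_repr]
    change (Pi.single x (1 : ℚ) : X → ℚ) (g⁻¹ • x) = _
    rw [Pi.single_apply]
    congr 1
    rw [inv_smul_eq_iff]
    exact propext eq_comm
  rw [Finset.sum_congr rfl (fun x _ => this x), Finset.sum_boole, Nat.card_eq_fintype_card,
    Fintype.card_subtype]

variable [Fintype G]

/-- The unnormalized inner product of functions on a finite group. -/
def pairing (f h : G → ℚ) : ℚ := ∑ g, f g * h g⁻¹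

theorem pairing_comm (f h : G → ℚ) : pairing f h = pairing h f := by
  rw [pairing, pairing, ← Equiv.sum_comp (Equiv.inv G)]
  simp [mul_comm]

theorem pairing_sub_left (a b c : G → ℚ) : pairing (a - b) c = pairing a c - pairing b c := by
  simp [pairing, sub_mul, Finset.sum_sub_distrib]

theorem pairing_sub_right (a b c : G → ℚ) : pairing c (a - b) = pairing c a - pairing c b := by
  simp [pairing, mul_sub, Finset.sum_sub_distrib]

theorem pairing_character {V W : Type} [AddCommGroup V] [Module ℚ V] [FiniteDimensional ℚ V]
    [AddCommGroup W] [Module ℚ W] [FiniteDimensional ℚ W]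
    (ρ : Representation ℚ G V) (σ : Representation ℚ G W) :
    pairing σ.character ρ.character =
      Nat.card G * (Module.finrank ℚ (Representation.IntertwiningMap ρ σ) : ℚ) := by
  have h0 : (Nat.card G : ℚ) ≠ 0 := by
    exact_mod_cast Nat.card_pos.ne'
  have : Invertible (Nat.card G : ℚ) := invertibleOfNonzero h0
  rw [← Representation.card_inv_mul_sum_char_mul_char_eq_finrank, pairing]
  field_simp

theorem IsChar.pairing_nonneg {f h : G → ℚ} (hf : IsChar f) (hh : IsChar h) :
    0 ≤ pairing f h := by
  obtain ⟨V, _, _, _, ρ, rfl⟩ := hf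
  obtain ⟨W, _, _, _, σ, rfl⟩ := hh
  rw [pairing_character]
  positivity

theorem exists_compl_character {V : Type} [AddCommGroup V] [Module ℚ V] [FiniteDimensional ℚ V]
    (ρ : Representation ℚ G V) (K : Subrepresentation ρ) :
    ∃ W : Subrepresentation ρ, IsCompl K.toSubmodule W.toSubmodule ∧
      ρ.character = K.toRepresentation.character + W.toRepresentation.character := by
  have h0 : (Nat.card G : ℚ) ≠ 0 := by
    exact_mod_cast Nat.card_pos.ne'
  have : NeZero (Nat.card G : ℚ) := ⟨h0⟩
  have hs : Representation.IsSemisimpleRepresentation ρ := inferInstance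
  obtain ⟨W, hW⟩ := exists_isCompl K
  have hW' : IsCompl K.toSubmodule W.toSubmodule := by
    constructor
    · rw [disjoint_iff]
      have := hW.inf_eq_bot
      rw [← Subrepresentation.toSubmodule_inf, this]; rfl
    · rw [codisjoint_iff]
      have := hW.sup_eq_top
      rw [← Subrepresentation.toSubmodule_sup, this]; rfl
  refine ⟨W, hW', ?_⟩
  rw [← character_prod]
  symm
  refine Representation.char_iso (Representation.Equiv.mk
    (Submodule.prodEquivOfIsCompl _ _ hW') ?_)
  intro g
  ext x
  · simp
    rfl
  · simp
    rfl

/-- A nonzero equivariant map lets one remove a common constituent. -/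
theorem exists_smaller {V W : Type} [AddCommGroup V] [Module ℚ V] [FiniteDimensional ℚ V]
    [AddCommGroup W] [Module ℚ W] [FiniteDimensional ℚ W]
    (ρ : Representation ℚ G V) (σ : Representation ℚ G W)
    (φ : Representation.IntertwiningMap ρ σ) (hφ : φ ≠ 0) :
    ∃ (K : Subrepresentation ρ) (L : Subrepresentation σ),
      Module.finrank ℚ K.toSubmodule < Module.finrank ℚ V ∧
      ρ.character - σ.character = K.toRepresentation.character - L.toRepresentation.character := by
  obtain ⟨A, hA, hAc⟩ := exists_compl_character ρ φ.ker
  obtain ⟨B, hB, hBc⟩ := exists_compl_character σ φ.range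
  have hiso : A.toRepresentation.character = φ.range.toRepresentation.character := by
    let e : A.toSubmodule →ₗ[ℚ] φ.range.toSubmodule :=
      (φ.toLinearMap.comp A.toSubmodule.subtype).codRestrict _ (fun x => ⟨x.1, rfl⟩)
    have he : Function.Bijective e := by
      constructor
      · rw [← LinearMap.ker_eq_bot, LinearMap.ker_eq_bot']
        intro x hx
        have h1 : (x : V) ∈ φ.ker.toSubmodule := by
          have := congrArg Subtype.val hx
          exact this
        have h2 := hA.disjoint.le_bot ⟨h1, x.2⟩
        exact Subtype.ext h2
      · rintro ⟨y, ⟨v, rfl⟩⟩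
        have hv : v ∈ φ.ker.toSubmodule ⊔ A.toSubmodule := by
          rw [hA.sup_eq_top]; trivial
        obtain ⟨a, ha, b, hb, rfl⟩ := Submodule.mem_sup.1 hv
        refine ⟨⟨b, hb⟩, Subtype.ext ?_⟩
        have ha' : φ.toLinearMap a = 0 := ha
        change φ.toLinearMap b = φ.toLinearMap (a + b)
        rw [map_add, ha', zero_add]
    refine Representation.char_iso (Representation.Equiv.mk (LinearEquiv.ofBijective e he) ?_)
    intro g
    ext x
    exact Representation.IntertwiningMap.isIntertwining _ _ φ g x
  refine ⟨φ.ker, B, ?_, ?_⟩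
  · apply Submodule.finrank_lt
    intro h
    apply hφ
    ext v
    have : v ∈ φ.ker.toSubmodule := by rw [h]; trivial
    exact this
  · rw [hAc, hBc, hiso]; abel

theorem isChar_of_virtual_aux (N : ℕ) {V W : Type} [AddCommGroup V] [Module ℚ V]
    [FiniteDimensional ℚ V] [AddCommGroup W] [Module ℚ W] [FiniteDimensional ℚ W]
    (ρ : Representation ℚ G V) (σ : Representation ℚ G W) (hN : Module.finrank ℚ V ≤ N)
    (h1 : pairing (ρ.character - σ.character) (ρ.character - σ.character) = Nat.card G)
    (φ : G → ℚ) (hφ : IsChar φ) (h2 : 0 < pairing (ρ.character - σ.character) φ) :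
    IsChar (ρ.character - σ.character) := by
  induction N using Nat.strong_induction_on generalizing V W with
  | _ N ih =>
  by_cases hh : ∃ f : Representation.IntertwiningMap ρ σ, f ≠ 0
  · obtain ⟨f, hf⟩ := hh
    obtain ⟨K, L, hlt, heq⟩ := exists_smaller ρ σ f hf
    rw [heq] at h1 h2 ⊢
    exact ih _ (lt_of_lt_of_le hlt hN) K.toRepresentation L.toRepresentation le_rfl h1 h2
  · push Not at hh
    have hzero : pairing σ.character ρ.character = 0 := by
      rw [pairing_character]
      have : Subsingleton (Representation.IntertwiningMap ρ σ) :=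
        ⟨fun a b => by rw [hh a, hh b]⟩
      simp [Module.finrank_zero_of_subsingleton]
    have hG : (0 : ℚ) < Nat.card G := by exact_mod_cast Nat.card_pos
    rw [pairing_sub_left, pairing_sub_right, pairing_sub_right,
      pairing_comm ρ.character σ.character,
      hzero, pairing_character, pairing_character] at h1
    have h3 : Module.finrank ℚ (Representation.IntertwiningMap ρ ρ) +
        Module.finrank ℚ (Representation.IntertwiningMap σ σ) = 1 := by
      have : (Nat.card G : ℚ) * ((Module.finrank ℚ (Representation.IntertwiningMap ρ ρ) : ℚ) +
        Module.finrank ℚ (Representation.IntertwiningMap σ σ)) = Nat.card G * 1 := by linarith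
      have := mul_left_cancel₀ hG.ne' this
      exact_mod_cast this
    have key : ∀ {U : Type} [AddCommGroup U] [Module ℚ U] [FiniteDimensional ℚ U]
        (τ : Representation ℚ G U),
        Module.finrank ℚ (Representation.IntertwiningMap τ τ) = 0 → τ.character = 0 := by
      intro U _ _ _ τ h
      have : Module.Finite ℚ (Representation.IntertwiningMap τ τ) :=
        Module.Finite.of_injective (Representation.IntertwiningMap.toLinearMapl τ τ)
          (fun a b hab => Representation.IntertwiningMap.ext hab)
      have hs : Subsingleton (Representation.IntertwiningMap τ τ) :=
        Module.finrank_zero_iff.1 h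
      have hid : Representation.IntertwiningMap.id τ = 0 := Subsingleton.elim _ _
      have hU : ∀ u : U, u = 0 := fun u => by
        have := congrArg (fun f : Representation.IntertwiningMap τ τ => f u) hid
        exact this
      ext g
      rw [Representation.character]
      have : τ g = 0 := by ext u; exact (hU _).trans (hU _).symm
      rw [this, map_zero]
      rfl
    rcases Nat.eq_zero_or_pos (Module.finrank ℚ (Representation.IntertwiningMap ρ ρ)) with h4 | h4
    · rw [key ρ h4, pairing_sub_left] at h2
      have h5 := (isChar_character σ).pairing_nonneg hφ
      have h6 : pairing (0 : G → ℚ) φ = 0 := by simp [pairing]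
      linarith
    · have h5 : Module.finrank ℚ (Representation.IntertwiningMap σ σ) = 0 := by omega
      rw [key σ h5, sub_zero]
      exact isChar_character ρ

/-- A virtual character of norm one having positive inner product with some character
is a character. -/
theorem isChar_of_virtual {a b φ : G → ℚ} (ha : IsChar a) (hb : IsChar b) (hφ : IsChar φ)
    (h1 : pairing (a - b) (a - b) = Nat.card G) (h2 : 0 < pairing (a - b) φ) :
    IsChar (a - b) := by
  obtain ⟨V, _, _, _, ρ, rfl⟩ := ha
  obtain ⟨W, _, _, _, σ, rfl⟩ := hb
  exact isChar_of_virtual_aux _ ρ σ le_rfl h1 φ hφ h2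

end Characters

end

section

section Alternants

open MvPolynomial

variable {n : ℕ} {R : Type*} [CommRing R]

/-- The monomial with exponent vector `e`. -/
def xp (R : Type*) [CommRing R] (e : Fin n → ℕ) : MvPolynomial (Fin n) R :=
  monomial (Finsupp.equivFunOnFinite.symm e) 1

/-- The coefficient at the exponent vector `e`. -/
def cf (e : Fin n → ℕ) (P : MvPolynomial (Fin n) R) : R :=
  coeff (Finsupp.equivFunOnFinite.symm e) P

theorem ext_cf {P Q : MvPolynomial (Fin n) R} (h : ∀ e, cf e P = cf e Q) : P = Q := by
  ext m
  simpa [cf] using h m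

@[simp] theorem cf_zero (e : Fin n → ℕ) : cf e (0 : MvPolynomial (Fin n) R) = 0 := by
  simp [cf]

@[simp] theorem cf_add (e : Fin n → ℕ) (P Q : MvPolynomial (Fin n) R) :
    cf e (P + Q) = cf e P + cf e Q := by
  simp [cf]

@[simp] theorem cf_sum {ι : Type*} (e : Fin n → ℕ) (s : Finset ι)
    (P : ι → MvPolynomial (Fin n) R) : cf e (∑ i ∈ s, P i) = ∑ i ∈ s, cf e (P i) := by
  simp [cf, coeff_sum]

@[simp] theorem cf_C_mul (e : Fin n → ℕ) (r : R) (P : MvPolynomial (Fin n) R) :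
    cf e (C r * P) = r * cf e P := by
  simp [cf]

@[simp] theorem cf_intCast_mul (e : Fin n → ℕ) (z : ℤ) (P : MvPolynomial (Fin n) R) :
    cf e ((z : MvPolynomial (Fin n) R) * P) = z * cf e P := by
  rw [← cf_C_mul, map_intCast]

theorem cf_xp (e f : Fin n → ℕ) : cf e (xp R f) = if f = e then 1 else 0 := by
  rw [cf, xp, coeff_monomial]
  simp

theorem xp_add (e f : Fin n → ℕ) : xp R (e + f) = xp R e * xp R f := by
  have h : Finsupp.equivFunOnFinite.symm (e + f) =
      Finsupp.equivFunOnFinite.symm e + Finsupp.equivFunOnFinite.symm f := by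
    ext i; simp
  rw [xp, xp, xp, monomial_mul, one_mul, h]

theorem xp_zero : xp R (0 : Fin n → ℕ) = 1 := by
  have h : Finsupp.equivFunOnFinite.symm (0 : Fin n → ℕ) = 0 := by
    ext i; simp
  rw [xp, h]
  rfl

theorem xp_sum {ι : Type*} (s : Finset ι) (e : ι → Fin n → ℕ) :
    xp R (∑ i ∈ s, e i) = ∏ i ∈ s, xp R (e i) := by
  induction s using Finset.induction_on with
  | empty => simp [xp_zero]
  | insert a s ha ih => rw [Finset.sum_insert ha, Finset.prod_insert ha, xp_add, ih]

theorem cf_xp_mul (e f : Fin n → ℕ) (P : MvPolynomial (Fin n) R) :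
    cf e (xp R f * P) = if f ≤ e then cf (e - f) P else 0 := by
  have h : Finsupp.equivFunOnFinite.symm (e - f) =
      Finsupp.equivFunOnFinite.symm e - Finsupp.equivFunOnFinite.symm f := by
    ext i; simp
  rw [cf, cf, xp, coeff_monomial_mul', one_mul, h]
  congr 1

theorem cf_rename (σ : Perm (Fin n)) (e : Fin n → ℕ) (P : MvPolynomial (Fin n) R) :
    cf e (rename σ P) = cf (e ∘ σ) P := by
  rw [cf, cf, ← coeff_rename_mapDomain σ σ.injective P (Finsupp.equivFunOnFinite.symm (e ∘ σ))]
  congr 1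
  ext i
  obtain ⟨j, rfl⟩ := σ.surjective i
  rw [Finsupp.mapDomain_apply σ.injective]
  simp

/-- Antisymmetric polynomials. -/
def AS (P : MvPolynomial (Fin n) R) : Prop :=
  ∀ (σ : Perm (Fin n)) (e : Fin n → ℕ), cf (e ∘ σ) P = ((Perm.sign σ : ℤ) : R) * cf e P

/-- Symmetric polynomials. -/
def Sy (P : MvPolynomial (Fin n) R) : Prop :=
  ∀ (σ : Perm (Fin n)) (e : Fin n → ℕ), cf (e ∘ σ) P = cf e P

theorem AS_iff {P : MvPolynomial (Fin n) R} :
    AS P ↔ ∀ σ : Perm (Fin n), rename σ P = ((Perm.sign σ : ℤ) : MvPolynomial (Fin n) R) * P := by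
  constructor
  · intro h σ
    apply ext_cf
    intro e
    rw [cf_rename, h, cf_intCast_mul]
  · intro h σ e
    rw [← cf_rename, h, cf_intCast_mul]

theorem Sy_iff {P : MvPolynomial (Fin n) R} :
    Sy P ↔ ∀ σ : Perm (Fin n), rename σ P = P := by
  constructor
  · intro h σ
    apply ext_cf
    intro e
    rw [cf_rename, h]
  · intro h σ e
    rw [← cf_rename, h]

theorem AS.mul_Sy {P Q : MvPolynomial (Fin n) R} (hP : AS P) (hQ : Sy Q) : AS (P * Q) := by
  rw [AS_iff] at hP ⊢
  rw [Sy_iff] at hQ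
  intro σ
  rw [map_mul, hP, hQ, mul_assoc]

theorem Sy.mul {P Q : MvPolynomial (Fin n) R} (hP : Sy P) (hQ : Sy Q) : Sy (P * Q) := by
  rw [Sy_iff] at *
  intro σ
  rw [map_mul, hP, hQ]

theorem Sy_one : Sy (1 : MvPolynomial (Fin n) R) := by
  rw [Sy_iff]; simp

theorem Sy_zero : Sy (0 : MvPolynomial (Fin n) R) := by
  rw [Sy_iff]; simp

theorem Sy.prod {ι : Type*} (s : Finset ι) (P : ι → MvPolynomial (Fin n) R)
    (h : ∀ i ∈ s, Sy (P i)) : Sy (∏ i ∈ s, P i) :=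
  Finset.prod_induction P Sy (fun _ _ => Sy.mul) Sy_one h

theorem Sy.add {P Q : MvPolynomial (Fin n) R} (hP : Sy P) (hQ : Sy Q) : Sy (P + Q) := by
  rw [Sy_iff] at *
  intro σ
  rw [map_add, hP, hQ]

theorem Sy.intCast_mul (z : ℤ) {P : MvPolynomial (Fin n) R} (hP : Sy P) :
    Sy ((z : MvPolynomial (Fin n) R) * P) := by
  rw [Sy_iff] at *
  intro σ
  rw [map_mul, hP, map_intCast]

theorem Sy.sum {ι : Type*} (s : Finset ι) (P : ι → MvPolynomial (Fin n) R)
    (h : ∀ i ∈ s, Sy (P i)) : Sy (∑ i ∈ s, P i) :=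
  Finset.sum_induction P Sy (fun _ _ => Sy.add) Sy_zero h

theorem AS.C_mul (r : R) {P : MvPolynomial (Fin n) R} (hP : AS P) : AS (C r * P) := by
  intro σ e
  rw [cf_C_mul, cf_C_mul, hP]
  ring

theorem AS.sum {ι : Type*} (s : Finset ι) (P : ι → MvPolynomial (Fin n) R)
    (h : ∀ i ∈ s, AS (P i)) : AS (∑ i ∈ s, P i) := by
  intro σ e
  rw [cf_sum, cf_sum, Finset.mul_sum]
  exact Finset.sum_congr rfl (fun i hi => h i hi σ e)

theorem cf_eq_zero_of_not_injective [IsDomain R] [CharZero R] {P : MvPolynomial (Fin n) R}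
    (hP : AS P) {e : Fin n → ℕ} (he : ¬ Function.Injective e) : cf e P = 0 := by
  simp only [Function.Injective, not_forall] at he
  obtain ⟨i, j, hij, hne⟩ := he
  have h := hP (Equiv.swap i j) e
  have h2 : e ∘ Equiv.swap i j = e := by
    ext k
    simp only [Function.comp]
    by_cases h1 : k = i
    · subst h1; rw [Equiv.swap_apply_left, hij]
    · by_cases h3 : k = j
      · subst h3; rw [Equiv.swap_apply_right, hij]
      · rw [Equiv.swap_apply_of_ne_of_ne h1 h3]
  rw [h2, Perm.sign_swap hne] at h
  simp only [Units.val_neg, Units.val_one, Int.cast_neg, Int.cast_one, neg_mul, one_mul] at h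
  exact self_eq_neg.1 h

/-- The alternant of the exponent vector `e`. -/
def alt (R : Type*) [CommRing R] (e : Fin n → ℕ) : MvPolynomial (Fin n) R :=
  ∑ σ : Perm (Fin n), ((Perm.sign σ : ℤ) : MvPolynomial (Fin n) R) * xp R (e ∘ σ)

theorem cf_alt (e g : Fin n → ℕ) :
    cf g (alt R e) = ∑ σ : Perm (Fin n), ((Perm.sign σ : ℤ) : R) * if e ∘ σ = g then 1 else 0 := by
  rw [alt, cf_sum]
  exact Finset.sum_congr rfl (fun σ _ => by rw [cf_intCast_mul, cf_xp])

theorem AS_alt (e : Fin n → ℕ) : AS (alt R e) := by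
  intro τ g
  rw [cf_alt, cf_alt, ← Equiv.sum_comp (Equiv.mulRight τ), Finset.mul_sum]
  refine Finset.sum_congr rfl (fun σ _ => ?_)
  have : (e ∘ ⇑((Equiv.mulRight τ) σ) = g ∘ τ) ↔ (e ∘ σ = g) := by
    rw [Equiv.coe_mulRight, Perm.coe_mul, ← Function.comp_assoc]
    exact (τ.surjective.injective_comp_right).eq_iff
  simp only [this]
  rw [Equiv.coe_mulRight, Perm.sign_mul]
  push_cast
  ring

/-- Partitions with at most `n` parts. -/
def IsPar (n : ℕ) (l : ℕ → ℕ) : Prop := Antitone l ∧ ∀ i, n ≤ i → l i = 0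

/-- The strictly decreasing vector `l + δ`. -/
def up (n : ℕ) (l : ℕ → ℕ) : Fin n → ℕ := fun i => l i + (n - 1 - i)

theorem IsPar.up_strictAnti {l : ℕ → ℕ} (hl : IsPar n l) : StrictAnti (up n l) := by
  intro i j hij
  have h1 := hl.1 (show (i : ℕ) ≤ j from hij.le)
  have h2 : (i : ℕ) < j := hij
  have := j.2
  simp only [up]
  omega

theorem up_inj {l m : ℕ → ℕ} (hl : IsPar n l) (hm : IsPar n m) (h : up n l = up n m) : l = m := by
  ext i
  by_cases hi : i < n
  · have := congrFun h ⟨i, hi⟩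
    simpa [up] using this
  · rw [hl.2 i (by omega), hm.2 i (by omega)]

theorem exists_up {e : Fin n → ℕ} (he : StrictAnti e) : ∃ l, IsPar n l ∧ up n l = e := by
  have key : ∀ (k : ℕ) (i : Fin n), n - 1 - i = k → n - 1 - (i : ℕ) ≤ e i := by
    intro k
    induction k with
    | zero => intro i hi; omega
    | succ k ih =>
      intro i hi
      have h1 : (i : ℕ) + 1 < n := by omega
      have h2 := ih ⟨i + 1, h1⟩ (by simp only; omega)
      have h3 : e ⟨i + 1, h1⟩ < e i := he (by rw [Fin.lt_def]; simp)
      simp only at h2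
      omega
  have step : ∀ i (h : i + 1 < n), e ⟨i + 1, h⟩ < e ⟨i, by omega⟩ := fun i h =>
    he (by rw [Fin.lt_def]; simp)
  refine ⟨fun i => if h : i < n then e ⟨i, h⟩ - (n - 1 - i) else 0, ⟨?_, ?_⟩, ?_⟩
  · apply antitone_nat_of_succ_le
    intro i
    by_cases h : i + 1 < n
    · have := step i h
      have h3 := key _ ⟨i + 1, h⟩ rfl
      have h4 := key _ ⟨i, by omega⟩ rfl
      simp only at h3 h4
      simp only [h, show i < n by omega, dif_pos]
      omega
    · simp [h]
  · intro i hi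
    simp [show ¬ i < n by omega]
  · ext ⟨i, hi⟩
    have h4 := key _ ⟨i, hi⟩ rfl
    simp only [up, hi, dif_pos]
    simp only at h4
    omega

theorem perm_eq_one_of_strictAnti {e f : Fin n → ℕ} (he : StrictAnti e) (hf : StrictAnti f)
    {σ : Perm (Fin n)} (h : f ∘ σ = e) : σ = 1 := by
  have hs : StrictMono σ := by
    intro i j hij
    have := he hij
    rw [← h] at this
    exact hf.lt_iff_gt.1 this
  ext i
  have := Subsingleton.elim (hs.orderIsoOfSurjective σ σ.surjective) (OrderIso.refl _)
  exact congrArg Fin.val (congrArg (fun f : Fin n ≃o Fin n => f i) this)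

theorem cf_alt_of_strictAnti {e f : Fin n → ℕ} (he : StrictAnti e) (hf : StrictAnti f) :
    cf e (alt R f) = if f = e then 1 else 0 := by
  rw [cf_alt, Finset.sum_eq_single 1]
  · simp
  · intro σ _ hσ
    rw [if_neg, mul_zero]
    intro h
    exact hσ (perm_eq_one_of_strictAnti he hf h)
  · simp

theorem cf_alt_up {l m : ℕ → ℕ} (hl : IsPar n l) (hm : IsPar n m) :
    cf (up n l) (alt R (up n m)) = if m = l then 1 else 0 := by
  rw [cf_alt_of_strictAnti hl.up_strictAnti hm.up_strictAnti]
  have : up n m = up n l ↔ m = l := ⟨fun h => up_inj hm hl h, fun h => by rw [h]⟩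
  simp only [this]

theorem AS.ext [IsDomain R] [CharZero R] {P Q : MvPolynomial (Fin n) R} (hP : AS P) (hQ : AS Q)
    (h : ∀ l, IsPar n l → cf (up n l) P = cf (up n l) Q) : P = Q := by
  apply ext_cf
  intro e
  by_cases he : Function.Injective e
  · let σ : Perm (Fin n) := Fin.revPerm.trans (Tuple.sort e)
    have hs : StrictAnti (e ∘ σ) := by
      have h1 : Monotone (e ∘ Tuple.sort e) := Tuple.monotone_sort e
      have h2 : StrictMono (e ∘ Tuple.sort e) :=
        h1.strictMono_of_injective (he.comp (Tuple.sort e).injective)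
      intro i j hij
      exact h2 (Fin.rev_lt_rev.2 hij)
    obtain ⟨l, hl, hle⟩ := exists_up hs
    have := h l hl
    rw [hle, hP, hQ] at this
    rcases Int.units_eq_one_or (Perm.sign σ) with hs | hs <;> rw [hs] at this <;> simpa using this
  · rw [cf_eq_zero_of_not_injective hP he, cf_eq_zero_of_not_injective hQ he]

theorem AS.expand [IsDomain R] [CharZero R] {P : MvPolynomial (Fin n) R} (hP : AS P)
    (B : Finset (ℕ → ℕ)) (hB : ∀ l ∈ B, IsPar n l)
    (hB' : ∀ l, IsPar n l → l ∉ B → cf (up n l) P = 0) :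
    P = ∑ l ∈ B, C (cf (up n l) P) * alt R (up n l) := by
  apply AS.ext hP (AS.sum _ _ (fun l _ => (AS_alt _).C_mul _))
  intro m hm
  rw [cf_sum]
  have : ∀ l ∈ B, cf (up n m) (C (cf (up n l) P) * alt R (up n l)) =
      if l = m then cf (up n m) P else 0 := by
    intro l hl
    rw [cf_C_mul, cf_alt_up hm (hB l hl)]
    split_ifs with h
    · rw [h, mul_one]
    · rw [mul_zero]
  rw [Finset.sum_congr rfl this, Finset.sum_ite_eq' B m]
  split_ifs with h
  · rfl
  · exact hB' m hm h

theorem exists_support (P : MvPolynomial (Fin n) R) :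
    ∃ B : Finset (ℕ → ℕ), (∀ l ∈ B, IsPar n l) ∧
      ∀ l, IsPar n l → l ∉ B → cf (up n l) P = 0 := by
  have hfin : {l | IsPar n l ∧ cf (up n l) P ≠ 0}.Finite := by
    apply Set.Finite.of_finite_image (f := fun l => Finsupp.equivFunOnFinite.symm (up n l))
    · apply Set.Finite.subset P.support.finite_toSet
      rintro _ ⟨l, hl, rfl⟩
      simpa [MvPolynomial.mem_support_iff, cf] using hl.2
    · intro l hl m hm h
      exact up_inj hl.1 hm.1 (Finsupp.equivFunOnFinite.symm.injective h)
  refine ⟨hfin.toFinset, ?_, ?_⟩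
  · intro l hl
    rw [Set.Finite.mem_toFinset] at hl
    exact hl.1
  · intro l hl h
    rw [Set.Finite.mem_toFinset] at h
    by_contra hne
    exact h ⟨hl, hne⟩

/-- Coefficients of a product with an antisymmetric polynomial `P`: it suffices to know the
products with alternants. -/
theorem AS.cf_mul [IsDomain R] [CharZero R] {P : MvPolynomial (Fin n) R} (hP : AS P)
    (Q : MvPolynomial (Fin n) R) (e : Fin n → ℕ) (B : Finset (ℕ → ℕ)) (hB : ∀ l ∈ B, IsPar n l)
    (hB' : ∀ l, IsPar n l → l ∉ B → cf (up n l) P * cf e (alt R (up n l) * Q) = 0) :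
    cf e (P * Q) = ∑ l ∈ B, cf (up n l) P * cf e (alt R (up n l) * Q) := by
  obtain ⟨B', h1, h2⟩ := exists_support P
  have h3 : P = ∑ l ∈ B ∪ B', C (cf (up n l) P) * alt R (up n l) := by
    apply hP.expand
    · intro l hl
      rcases Finset.mem_union.1 hl with h | h
      · exact hB l h
      · exact h1 l h
    · intro l hl h
      exact h2 l hl (fun h' => h (Finset.mem_union_right _ h'))
  have h4 : cf e (P * Q) = ∑ l ∈ B ∪ B', cf (up n l) P * cf e (alt R (up n l) * Q) := by
    conv_lhs => rw [h3, Finset.sum_mul, cf_sum]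
    exact Finset.sum_congr rfl (fun l _ => by rw [mul_assoc, cf_C_mul])
  rw [h4]
  symm
  apply Finset.sum_subset Finset.subset_union_left
  intro l hl hlB
  apply hB' l _ hlB
  rcases Finset.mem_union.1 hl with h | h
  · exact absurd h hlB
  · exact h1 l h

end Alternants

end

section

section Pieri

open MvPolynomial

variable {n : ℕ} {R : Type*} [CommRing R]

/-- The complete homogeneous symmetric polynomial of degree `m` in `n` variables. -/
def hh (n : ℕ) (R : Type*) [CommRing R] (m : ℕ) : MvPolynomial (Fin n) R :=
  ∑ b ∈ piAntidiag univ m, xp R b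

theorem cf_hh (b : Fin n → ℕ) (m : ℕ) : cf b (hh n R m) = if ∑ i, b i = m then 1 else 0 := by
  rw [hh, cf_sum]
  simp only [cf_xp, Finset.sum_ite_eq', mem_piAntidiag]
  simp

theorem Sy_hh (m : ℕ) : Sy (hh n R m) := by
  intro σ e
  rw [cf_hh, cf_hh]
  simp only [Function.comp_apply, Equiv.sum_comp σ e]

theorem cf_alt_mul_hh (e f : Fin n → ℕ) (m : ℕ) :
    cf e (alt R f * hh n R m) = if ∑ i, e i = ∑ i, f i + m then
      Matrix.det (Matrix.of fun j i => if f j ≤ e i then (1 : R) else 0) else 0 := by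
  rw [alt, Finset.sum_mul, cf_sum, Matrix.det_apply']
  have key : ∀ σ : Perm (Fin n), cf e (((Perm.sign σ : ℤ) : MvPolynomial (Fin n) R) *
      xp R (f ∘ σ) * hh n R m) = if ∑ i, e i = ∑ i, f i + m then ((Perm.sign σ : ℤ) : R) *
        ∏ i, (if f (σ i) ≤ e i then (1 : R) else 0) else 0 := by
    intro σ
    rw [mul_assoc, cf_intCast_mul, cf_xp_mul, Finset.prod_ite_zero]
    by_cases h : f ∘ σ ≤ e
    · have h' : ∀ i ∈ (univ : Finset (Fin n)), f (σ i) ≤ e i := fun i _ => h i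
      rw [if_pos h, if_pos h', cf_hh]
      have h1 : ∑ i, (e - f ∘ σ) i + ∑ i, f i = ∑ i, e i := by
        rw [← Equiv.sum_comp σ f, ← Finset.sum_add_distrib]
        exact Finset.sum_congr rfl (fun i _ => Nat.sub_add_cancel (h i))
      have h2 : (∑ i, (e - f ∘ σ) i = m) ↔ (∑ i, e i = ∑ i, f i + m) := by omega
      simp only [h2, Finset.prod_const_one, mul_ite, mul_one, mul_zero]
    · have h' : ¬ ∀ i ∈ (univ : Finset (Fin n)), f (σ i) ≤ e i :=
        fun h' => h (fun i => h' i (mem_univ _))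
      rw [if_neg h, if_neg h']
      simp
  rw [Finset.sum_congr rfl (fun σ _ => key σ)]
  split_ifs with h
  · rfl
  · simp

/-- The determinant governing the Pieri rule. -/
theorem det_interlacing {e f : Fin n → ℕ} (he : StrictAnti e) (hf : StrictAnti f) :
    Matrix.det (Matrix.of fun j i => if f j ≤ e i then (1 : R) else 0) =
      if ∀ i j, f j ≤ e i ↔ i ≤ j then 1 else 0 := by
  set t : Fin n → ℕ := fun i => #{j | e i < f j} with ht
  have hlt : ∀ i j, e i < f j ↔ (j : ℕ) < t i := by
    intro i j
    constructor
    · intro h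
      have : Finset.Iic j ⊆ ({j | e i < f j} : Finset (Fin n)) := by
        intro k hk
        rw [Finset.mem_Iic] at hk
        simp only [mem_filter, mem_univ, true_and]
        exact lt_of_lt_of_le h (hf.antitone hk)
      have := Finset.card_le_card this
      rw [Fin.card_Iic] at this
      exact this
    · intro h
      by_contra h'
      have : ({j | e i < f j} : Finset (Fin n)) ⊆ Finset.Iio j := by
        intro k hk
        simp only [mem_filter, mem_univ, true_and] at hk
        rw [Finset.mem_Iio]
        by_contra h2
        exact h' (lt_of_lt_of_le hk (hf.antitone (not_lt.1 h2)))
      have := Finset.card_le_card this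
      rw [Fin.card_Iio] at this
      exact absurd h (not_lt.2 this)
  have hle : ∀ i j, f j ≤ e i ↔ t i ≤ j := by
    intro i j
    rw [← not_lt, hlt, not_lt]
  by_cases h1 : ∃ i, n ≤ t i
  · obtain ⟨i, hi⟩ := h1
    rw [if_neg, Matrix.det_eq_zero_of_column_eq_zero i]
    · intro j
      rw [Matrix.of_apply, if_neg]
      rw [hle]
      omega
    · intro h
      have := (h i i).2 le_rfl
      rw [hle] at this
      omega
  · push Not at h1
    by_cases h2 : Function.Injective t
    · have hmono : StrictMono (fun i => (⟨t i, h1 i⟩ : Fin n)) := by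
        have : Monotone (fun i => (⟨t i, h1 i⟩ : Fin n)) := by
          intro i j hij
          rw [Fin.mk_le_mk]
          apply Finset.card_le_card
          intro k hk
          simp only [mem_filter, mem_univ, true_and] at hk ⊢
          exact lt_of_le_of_lt (he.antitone hij) hk
        exact this.strictMono_of_injective (fun i j h => h2 (congrArg Fin.val h))
      have hid : ∀ i, t i = i := by
        intro i
        have := Subsingleton.elim (hmono.orderIsoOfSurjective _
          (Finite.injective_iff_surjective.1 hmono.injective)) (OrderIso.refl _)
        exact congrArg Fin.val (congrArg (fun f : Fin n ≃o Fin n => f i) this)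
      have hle' : ∀ i j, f j ≤ e i ↔ i ≤ j := by
        intro i j
        rw [hle, hid, Fin.le_def]
      rw [if_pos hle']
      simp only [hle']
      rw [Matrix.det_of_isLowerTriangular]
      · simp
      · intro i j hij
        rw [Matrix.of_apply, if_neg]
        exact not_le.2 hij
    · have h2' := h2
      simp only [Function.Injective, not_forall] at h2
      obtain ⟨i, j, hij, hne⟩ := h2
      rw [if_neg, Matrix.det_zero_of_column_eq hne]
      · intro k
        simp only [Matrix.of_apply, hle, hij]
      · intro h
        apply hne
        have a1 := (h i i).2 le_rfl
        have a2 := (h j j).2 le_rfl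
        rw [hle, ← hij, ← hle, h] at a2
        rw [hle, hij, ← hle, h] at a1
        exact le_antisymm a2 a1

/-- Interlacing: `l / m` is a horizontal strip. -/
def Hs (m l : ℕ → ℕ) : Prop := ∀ i, l (i + 1) ≤ m i ∧ m i ≤ l i

theorem Hs.isPar {m l : ℕ → ℕ} (h : Hs m l) (hl : IsPar n l) : IsPar n m :=
  ⟨antitone_nat_of_succ_le (fun i => ((h (i + 1)).2).trans (h i).1),
    fun i hi => Nat.le_zero.1 ((h i).2.trans (hl.2 i hi).le)⟩

theorem Hs.refl {l : ℕ → ℕ} (hl : Antitone l) : Hs l l := fun i => ⟨hl (Nat.le_succ i), le_rfl⟩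

theorem up_interlacing {m l : ℕ → ℕ} (hm : IsPar n m) (hl : IsPar n l) :
    (∀ i j, up n m j ≤ up n l i ↔ i ≤ j) ↔ Hs m l := by
  constructor
  · intro h i
    by_cases hi : i < n
    · have h1 := (h ⟨i, hi⟩ ⟨i, hi⟩).2 le_rfl
      simp only [up] at h1
      refine ⟨?_, by omega⟩
      by_cases hi' : i + 1 < n
      · have h2 := (h ⟨i + 1, hi'⟩ ⟨i, hi⟩).not.2 (by rw [Fin.mk_le_mk]; omega)
        simp only [up] at h2
        omega
      · rw [hl.2 _ (by omega)]
        omega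
    · rw [hm.2 i (by omega), hl.2 i (by omega), hl.2 (i + 1) (by omega)]
      simp
  · intro h i j
    constructor
    · intro h1
      by_contra h2
      have h3 : (j : ℕ) + 1 ≤ i := by omega
      have h4 := hl.1 h3
      have h5 := (h j).1
      simp only [up] at h1
      have := i.2
      omega
    · intro h1
      have h2 := (h j).2
      have h3 := hl.1 (show (i : ℕ) ≤ j from h1)
      have h4 : (i : ℕ) ≤ j := h1
      simp only [up]
      omega

/-- The size of a vector with `n` entries. -/
def sz (n : ℕ) (l : ℕ → ℕ) : ℕ := ∑ i ∈ range n, l i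

theorem sum_up (l : ℕ → ℕ) : ∑ i, up n l i = sz n l + ∑ i : Fin n, (n - 1 - (i : ℕ)) := by
  rw [sz, Finset.sum_range, ← Finset.sum_add_distrib]
  rfl

/-- The Pieri rule. -/
theorem pieri {m l : ℕ → ℕ} (hm : IsPar n m) (hl : IsPar n l) (k : ℕ) :
    cf (up n l) (alt R (up n m) * hh n R k) = if Hs m l ∧ sz n l = sz n m + k then 1 else 0 := by
  rw [cf_alt_mul_hh, det_interlacing hl.up_strictAnti hm.up_strictAnti, sum_up, sum_up]
  simp only [up_interlacing hm hl, ← ite_and]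
  have : (sz n l + ∑ i : Fin n, (n - 1 - (i : ℕ)) = sz n m + ∑ i : Fin n, (n - 1 - (i : ℕ)) + k ∧
    Hs m l) ↔ (Hs m l ∧ sz n l = sz n m + k) := by
    constructor
    · rintro ⟨h1, h2⟩
      exact ⟨h2, by omega⟩
    · rintro ⟨h1, h2⟩
      exact ⟨by omega, h1⟩
  simp only [this]

theorem finite_le {l : ℕ → ℕ} (hl : ∀ i, n ≤ i → l i = 0) : {m : ℕ → ℕ | m ≤ l}.Finite := by
  apply Set.Finite.of_finite_image (f := fun m (i : Fin n) => m i)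
  · apply Set.Finite.subset (Set.finite_Iic (fun i : Fin n => l i))
    rintro _ ⟨m, hm, rfl⟩ i
    exact hm i
  · intro m hm m' hm' h
    ext i
    by_cases hi : i < n
    · exact congrFun h ⟨i, hi⟩
    · have h1 : m i ≤ l i := hm i
      have h2 : m' i ≤ l i := hm' i
      have h3 := hl i (by omega)
      omega

/-- The finite set of partitions contained in `l`. -/
def below (n : ℕ) (l : ℕ → ℕ) : Finset (ℕ → ℕ) :=
  if h : ∀ i, n ≤ i → l i = 0 then (finite_le h).toFinset.filter (IsPar n) else ∅

theorem mem_below {l m : ℕ → ℕ} (hl : IsPar n l) : m ∈ below n l ↔ IsPar n m ∧ m ≤ l := by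
  rw [below, dif_pos hl.2]
  simp [and_comm]

theorem Hs.mem_below {m l : ℕ → ℕ} (h : Hs m l) (hl : IsPar n l) : m ∈ below n l :=
  (KroneckerLR.mem_below hl).2 ⟨h.isPar hl, fun i => (h i).2⟩

theorem AS.cf_mul_hh [IsDomain R] [CharZero R] {P : MvPolynomial (Fin n) R} (hP : AS P)
    {l : ℕ → ℕ} (hl : IsPar n l) (k : ℕ) :
    cf (up n l) (P * hh n R k) =
      ∑ m ∈ below n l with Hs m l ∧ sz n l = sz n m + k, cf (up n m) P := by
  rw [hP.cf_mul _ _ (below n l) (fun m hm => ((mem_below hl).1 hm).1), Finset.sum_filter]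
  · refine Finset.sum_congr rfl (fun m hm => ?_)
    rw [pieri ((mem_below hl).1 hm).1 hl]
    split_ifs <;> simp
  · intro m hm hmb
    rw [pieri hm hl, if_neg, mul_zero]
    intro h
    exact hmb (h.1.mem_below hl)

/-- A chain of partitions from `m` to `l` of length `r`, successive quotients being horizontal
strips. -/
structure IsCh (r : ℕ) (m l : ℕ → ℕ) (L : ℕ → ℕ → ℕ) : Prop where
  bot : L 0 = m
  top : ∀ k, r ≤ k → L k = l
  hs : ∀ k, Hs (L k) (L (k + 1))

variable {r : ℕ} {m l : ℕ → ℕ} {L : ℕ → ℕ → ℕ}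

theorem IsCh.mono (h : IsCh r m l L) (i : ℕ) : Monotone (fun k => L k i) :=
  monotone_nat_of_le_succ (fun k => (h.hs k i).2)

theorem IsCh.le (h : IsCh r m l L) (k : ℕ) : L k ≤ l := by
  intro i
  have := h.mono i (Nat.le_add_right k r)
  simpa [h.top (k + r) (by omega)] using this

theorem IsCh.isPar (h : IsCh r m l L) (hl : IsPar n l) (k : ℕ) : IsPar n (L k) := by
  have : ∀ d k, r - k = d → IsPar n (L k) := by
    intro d
    induction d with
    | zero => intro k hk; rw [h.top k (by omega)]; exact hl
    | succ d ih => intro k hk; exact (h.hs k).isPar (ih (k + 1) (by omega))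
  exact this _ k rfl

theorem finite_isCh (r : ℕ) (m : ℕ → ℕ) (hl : IsPar n l) : {L | IsCh r m l L}.Finite := by
  apply Set.Finite.of_finite_image (f := fun L (k : Fin r) => L k)
  · apply Set.Finite.subset (Set.Finite.pi' (fun _ : Fin r => finite_le hl.2))
    rintro _ ⟨L, hL, rfl⟩ k
    exact hL.le k
  · intro L hL L' hL' h
    ext k i
    by_cases hk : k < r
    · exact congrFun (congrFun h ⟨k, hk⟩) i
    · rw [hL.top k (by omega), hL'.top k (by omega)]

/-- The finite set of chains. -/
def chains (n r : ℕ) (m l : ℕ → ℕ) : Finset (ℕ → ℕ → ℕ) :=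
  if h : IsPar n l then (finite_isCh r m h).toFinset else ∅

theorem mem_chains (hl : IsPar n l) : L ∈ chains n r m l ↔ IsCh r m l L := by
  rw [chains, dif_pos hl]
  simp

/-- The chain `L` has content `c`. -/
def HasCt (n r : ℕ) (c : ℕ → ℕ) (L : ℕ → ℕ → ℕ) : Prop :=
  ∀ k < r, sz n (L (k + 1)) = sz n (L k) + c k

theorem card_chains_succ (hl : IsPar n l) (c : ℕ → ℕ) :
    #{L ∈ chains n (r + 1) m l | HasCt n (r + 1) c L} =
      ∑ p ∈ below n l with Hs p l ∧ sz n l = sz n p + c r,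
        #{L ∈ chains n r m p | HasCt n r c L} := by
  rw [Finset.card_eq_sum_card_fiberwise (f := fun L => L r)
    (t := {p ∈ below n l | Hs p l ∧ sz n l = sz n p + c r})]
  · refine Finset.sum_congr rfl (fun p hp => ?_)
    rw [mem_filter, mem_below hl] at hp
    obtain ⟨⟨hp, -⟩, hpl, hsz⟩ := hp
    refine Finset.card_bij' (fun L _ k => L (min k r)) (fun L _ k => if k ≤ r then L k else l)
      ?_ ?_ ?_ ?_
    · intro L hL
      rw [mem_filter, mem_filter, mem_chains hl] at hL
      obtain ⟨⟨hL, hc⟩, hr⟩ := hL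
      rw [mem_filter, mem_chains hp]
      refine ⟨⟨by simp [hL.bot], fun k hk => by simp [hk, hr], fun k => ?_⟩, fun k hk => ?_⟩
      · by_cases hk : k + 1 ≤ r
        · rw [min_eq_left hk, min_eq_left (by omega)]
          exact hL.hs k
        · rw [min_eq_right (by omega), min_eq_right (by omega), hr]
          exact Hs.refl hp.1
      · dsimp only
        rw [min_eq_left (by omega), min_eq_left (by omega)]
        exact hc k (by omega)
    · intro L hL
      rw [mem_filter, mem_chains hp] at hL
      obtain ⟨hL, hc⟩ := hL
      rw [mem_filter, mem_filter, mem_chains hl]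
      refine ⟨⟨⟨by simp [hL.bot], fun k hk => ?_, fun k => ?_⟩, fun k hk => ?_⟩, ?_⟩
      · rw [if_neg (by omega)]
      · by_cases hk : k + 1 ≤ r
        · rw [if_pos hk, if_pos (by omega)]
          exact hL.hs k
        · rw [if_neg hk]
          by_cases hk' : k ≤ r
          · rw [if_pos hk', hL.top k (by omega)]
            exact hpl
          · rw [if_neg hk']
            exact Hs.refl hl.1
      · dsimp only
        by_cases hk' : k + 1 ≤ r
        · rw [if_pos hk', if_pos (by omega)]
          exact hc k (by omega)
        · rw [if_neg hk', if_pos (by omega), hL.top k (by omega), show k = r by omega]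
          exact hsz
      · simp only [le_refl, if_true]
        exact hL.top r le_rfl
    · intro L hL
      rw [mem_filter, mem_filter, mem_chains hl] at hL
      obtain ⟨⟨hL, hc⟩, hr⟩ := hL
      ext1 k
      dsimp only
      split_ifs with hk
      · rw [min_eq_left hk]
      · rw [hL.top k (by omega)]
    · intro L hL
      rw [mem_filter, mem_chains hp] at hL
      obtain ⟨hL, hc⟩ := hL
      ext1 k
      dsimp only
      rw [if_pos (by omega)]
      by_cases hk : k ≤ r
      · rw [min_eq_left hk]
      · rw [min_eq_right (by omega), hL.top k (by omega), hL.top r le_rfl]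
  · intro L hL
    rw [mem_coe, mem_filter, mem_chains hl] at hL
    obtain ⟨hL, hc⟩ := hL
    have h1 := hL.hs r
    rw [hL.top (r + 1) le_rfl] at h1
    have h2 := hc r (by omega)
    rw [hL.top (r + 1) le_rfl] at h2
    rw [mem_coe, mem_filter]
    exact ⟨h1.mem_below hl, h1, h2⟩

theorem cf_alt_mul_prod_hh [IsDomain R] [CharZero R] (hm : IsPar n m) (hl : IsPar n l)
    (r : ℕ) (c : ℕ → ℕ) :
    cf (up n l) (alt R (up n m) * ∏ k ∈ range r, hh n R (c k)) =
      (#{L ∈ chains n r m l | HasCt n r c L} : R) := by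
  induction r generalizing l with
  | zero =>
    rw [Finset.prod_range_zero, mul_one, cf_alt_up hl hm]
    split_ifs with h
    · subst h
      have : {L ∈ chains n 0 m m | HasCt n 0 c L} = {fun _ => m} := by
        ext L
        rw [mem_filter, mem_chains hl, mem_singleton]
        constructor
        · rintro ⟨h, -⟩
          ext1 k
          exact h.top k (Nat.zero_le _)
        · rintro rfl
          exact ⟨⟨rfl, fun _ _ => rfl, fun _ => Hs.refl hl.1⟩, fun k hk => by omega⟩
      rw [this]
      simp
    · symm
      rw [Nat.cast_eq_zero, Finset.card_eq_zero, Finset.eq_empty_iff_forall_notMem]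
      intro L hL
      rw [mem_filter, mem_chains hl] at hL
      exact h (hL.1.bot.symm.trans (hL.1.top 0 le_rfl))
  | succ r ih =>
    rw [Finset.prod_range_succ, ← mul_assoc, AS.cf_mul_hh _ hl, card_chains_succ hl]
    · push_cast
      refine Finset.sum_congr rfl (fun p hp => ?_)
      rw [mem_filter, mem_below hl] at hp
      exact ih hp.1.1
    · exact (AS_alt _).mul_Sy (Sy.prod _ _ (fun _ _ => Sy_hh _))

end Pieri

end

section

section Lattice

variable {n : ℕ}

theorem sz_succ (i : ℕ) (l : ℕ → ℕ) : sz (i + 1) l = sz i l + l i := Finset.sum_range_succ _ _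

theorem sz_congr {i : ℕ} {l m : ℕ → ℕ} (h : ∀ j < i, l j = m j) : sz i l = sz i m :=
  Finset.sum_congr rfl (fun j hj => h j (Finset.mem_range.1 hj))

theorem sz_mono {l m : ℕ → ℕ} (h : l ≤ m) (i : ℕ) : sz i l ≤ sz i m :=
  Finset.sum_le_sum (fun j _ => h j)

theorem IsPar.sz_eq {l : ℕ → ℕ} (hl : IsPar n l) {i : ℕ} (hi : n ≤ i) : sz i l = sz n l := by
  induction i, hi using Nat.le_induction with
  | base => rfl
  | succ i hi ih => rw [sz_succ, ih, hl.2 i hi, add_zero]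

/-- Excess of the middle level of three levels of a chain, in the first `i` rows. -/
def exc (a b c : ℕ → ℕ) (i : ℕ) : ℕ := 2 * sz i b - (sz i a + sz i c)

/-- Reflection of the middle level of three consecutive levels of a chain, from row `i` on. -/
def flip3 (a b c : ℕ → ℕ) (i j : ℕ) : ℕ :=
  if j < i then b j
  else if j = i then (c i - (exc a b c i + 1)) + max (c (i + 1)) (a i) - b i
  else min (c j) (a (j - 1)) + max (c (j + 1)) (a j) - b j

/-- The hypotheses on three consecutive levels under which `flip3` is a sign-reversing move. -/
structure Flippable (a b c : ℕ → ℕ) (i : ℕ) : Prop where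
  hab : Hs a b
  hbc : Hs b c
  le : sz i a + sz i c ≤ 2 * sz i b
  prev : 0 < i → b (i - 1) ≤ a (i - 1) + exc a b c i
  viol : b i + exc a b c i < c i

variable {a b c : ℕ → ℕ} {i : ℕ}

theorem flip3_lt {j : ℕ} (h : j < i) : flip3 a b c i j = b j := if_pos h

theorem flip3_self : flip3 a b c i i =
    (c i - (exc a b c i + 1)) + max (c (i + 1)) (a i) - b i := by
  rw [flip3, if_neg (lt_irrefl i), if_pos rfl]

theorem flip3_gt {j : ℕ} (h : i < j) : flip3 a b c i j =
    min (c j) (a (j - 1)) + max (c (j + 1)) (a j) - b j := by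
  rw [flip3, if_neg (by omega), if_neg (by omega)]

theorem sz_flip3 {j : ℕ} (h : j ≤ i) : sz j (flip3 a b c i) = sz j b :=
  sz_congr (fun _ hk => flip3_lt (by omega))

theorem exc_flip3 : exc a (flip3 a b c i) c i = exc a b c i := by
  rw [exc, exc, sz_flip3 le_rfl]

theorem Flippable.bounds (h : Flippable a b c i) (j : ℕ) (hj : i ≤ j) :
    max (c (j + 1)) (a j) ≤ flip3 a b c i j ∧ flip3 a b c i j ≤ c j ∧
      (0 < j → flip3 a b c i j ≤ a (j - 1)) := by
  obtain ⟨h1, h2⟩ := h.hab j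
  obtain ⟨h3, h4⟩ := h.hbc j
  rcases hj.eq_or_lt with rfl | hj
  · have := h.viol
    have h5 := h.prev
    rw [flip3_self]
    refine ⟨by omega, by omega, fun h0 => ?_⟩
    have h6 := (h.hbc (i - 1)).1
    rw [Nat.sub_add_cancel h0] at h6
    have h7 := h5 h0
    omega
  · have h6 := (h.hab (j - 1)).1
    rw [Nat.sub_add_cancel (by omega)] at h6
    rw [flip3_gt hj]
    omega

theorem Flippable.hs_left (h : Flippable a b c i) : Hs a (flip3 a b c i) := by
  intro j
  obtain ⟨h1, h2⟩ := h.hab j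
  constructor
  · by_cases hj : j + 1 < i
    · rw [flip3_lt hj]
      exact h1
    · have := (h.bounds (j + 1) (by omega)).2.2 (by omega)
      simpa using this
  · by_cases hj : j < i
    · rw [flip3_lt hj]
      exact h2
    · have := (h.bounds j (by omega)).1
      omega

theorem Flippable.hs_right (h : Flippable a b c i) : Hs (flip3 a b c i) c := by
  intro j
  by_cases hj : j < i
  · rw [flip3_lt hj]
    exact h.hbc j
  · have := h.bounds j (by omega)
    omega

theorem Flippable.flip3_viol (h : Flippable a b c i) :
    flip3 a b c i i + exc a b c i < c i := by
  have := h.viol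
  have h1 := h.hbc i
  have h2 := h.hab i
  rw [flip3_self]
  omega

theorem Flippable.flip (h : Flippable a b c i) : Flippable a (flip3 a b c i) c i where
  hab := h.hs_left
  hbc := h.hs_right
  le := by rw [sz_flip3 le_rfl]; exact h.le
  prev h0 := by
    rw [flip3_lt (by omega), exc_flip3]
    exact h.prev h0
  viol := by
    rw [exc_flip3]
    exact h.flip3_viol

theorem Flippable.flip3_flip3 (h : Flippable a b c i) :
    flip3 a (flip3 a b c i) c i = b := by
  ext j
  rcases lt_trichotomy j i with hj | rfl | hj
  · rw [flip3_lt hj, flip3_lt hj]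
  · have := h.viol
    have h1 := h.hbc j
    have h2 := h.hab j
    rw [flip3_self, exc_flip3, flip3_self]
    omega
  · have h1 := h.hbc j
    have h2 := h.hab j
    have h6 := (h.hab (j - 1)).1
    rw [Nat.sub_add_cancel (by omega)] at h6
    rw [flip3_gt hj, flip3_gt hj]
    omega

theorem Flippable.sz_aux (h : Flippable a b c i) (t : ℕ) (ht : i + 1 ≤ t) :
    sz t (flip3 a b c i) + sz t b + min (c t) (a (t - 1)) + 1 = sz (t + 1) c + sz t a := by
  induction t, ht using Nat.le_induction with
  | base =>
    have h0 := h.le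
    have h1 := h.hbc i
    have h2 := h.hab i
    have h3 := h.viol
    simp only [sz_succ, sz_flip3 le_rfl, flip3_self, Nat.add_sub_cancel]
    have h4 : exc a b c i + (sz i a + sz i c) = 2 * sz i b := by
      rw [exc]; omega
    omega
  | succ t ht ih =>
    have h1 := h.hbc t
    have h2 := h.hab t
    have h6 := (h.hab (t - 1)).1
    rw [Nat.sub_add_cancel (by omega)] at h6
    rw [sz_succ t, sz_succ t b, sz_succ (t + 1), sz_succ t a, flip3_gt (by omega),
      Nat.add_sub_cancel]
    omega

theorem Flippable.sz_flip3 (h : Flippable a b c i) (hc : IsPar n c) :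
    sz n (flip3 a b c i) + sz n b + 1 = sz n c + sz n a := by
  have hi : i < n := by
    by_contra hi
    have := h.viol
    rw [hc.2 i (by omega)] at this
    omega
  have := h.sz_aux n hi
  rw [sz_succ, hc.2 n le_rfl] at this
  omega

/-- A violation of the lattice condition in row `i` between the levels `k` and `k + 1`. -/
def Viol (L : ℕ → ℕ → ℕ) (i k : ℕ) : Prop :=
  sz (i + 1) (L (k + 1)) + sz i (L (k + 1)) < sz (i + 1) (L (k + 2)) + sz i (L k)

/-- The lattice condition on chains. -/
def Lat (L : ℕ → ℕ → ℕ) : Prop := ∀ i k, ¬ Viol L i k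

/-- The pair `(i, k)` is the violation selected by the involution. -/
structure Sel (L : ℕ → ℕ → ℕ) (p : ℕ × ℕ) : Prop where
  viol : Viol L p.1 p.2
  first : ∀ i < p.1, ∀ k, ¬ Viol L i k
  last : ∀ k, p.2 < k → ¬ Viol L p.1 k

theorem Sel.unique {L : ℕ → ℕ → ℕ} {p q : ℕ × ℕ} (hp : Sel L p) (hq : Sel L q) : p = q := by
  have h1 : p.1 = q.1 := by
    rcases lt_trichotomy p.1 q.1 with h | h | h
    · exact absurd hp.viol (hq.first _ h _)
    · exact h
    · exact absurd hq.viol (hp.first _ h _)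
  have h2 : p.2 = q.2 := by
    rcases lt_trichotomy p.2 q.2 with h | h | h
    · exact absurd (h1 ▸ hq.viol) (hp.last _ h)
    · exact h
    · exact absurd (h1 ▸ hp.viol) (hq.last _ h)
  exact Prod.ext h1 h2

variable {r : ℕ} {m l : ℕ → ℕ} {L : ℕ → ℕ → ℕ}

theorem IsCh.viol_lt (h : IsCh r m l L) {i k : ℕ} (hv : Viol L i k) : k + 1 < r := by
  by_contra hk
  have h1 := h.mono
  have h2 : sz i (L k) ≤ sz i (L (k + 1)) := sz_mono (fun j => h.mono j (Nat.le_succ k)) i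
  rw [Viol, h.top (k + 1) (by omega), h.top (k + 2) (by omega)] at hv
  rw [h.top (k + 1) (by omega)] at h2
  omega

theorem IsCh.exists_sel (h : IsCh r m l L) (hL : ¬ Lat L) : ∃ p, Sel L p := by
  simp only [Lat, not_forall, not_not] at hL
  set i := Nat.find hL with hi
  have h1 : ∃ k, Viol L i k := Nat.find_spec hL
  have h2 : ∀ k, Viol L i k → k ≤ r := fun k hk => by have := h.viol_lt hk; omega
  refine ⟨(i, Nat.findGreatest (fun k => Viol L i k) r), ?_, ?_, ?_⟩
  · obtain ⟨k, hk⟩ := h1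
    exact Nat.findGreatest_spec (P := fun k => Viol L i k) (h2 k hk) hk
  · intro j hj k hk
    exact Nat.find_min hL hj ⟨k, hk⟩
  · intro k hk hv
    exact absurd (Nat.le_findGreatest (P := fun k => Viol L i k) (h2 k hv) hv) (not_le.2 hk)

theorem Sel.flippable (h : IsCh r m l L) {p : ℕ × ℕ} (hp : Sel L p) :
    Flippable (L p.2) (L (p.2 + 1)) (L (p.2 + 2)) p.1 := by
  obtain ⟨i, k⟩ := p
  have hv := hp.viol
  have hf := hp.first
  simp only [Viol, sz_succ] at hv hf
  have key : sz i (L k) + sz i (L (k + 2)) ≤ 2 * sz i (L (k + 1)) ∧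
      (0 < i → L (k + 1) (i - 1) ≤ L k (i - 1) + exc (L k) (L (k + 1)) (L (k + 2)) i) := by
    rw [exc]
    rcases i with _ | i
    · simp [sz]
    · have h1 := hf i (Nat.lt_succ_self i) k
      have h2 := (h.hs k i).2
      simp only [sz_succ, Nat.add_sub_cancel]
      omega
  refine ⟨h.hs k, h.hs (k + 1), key.1, key.2, ?_⟩
  simp only [exc]
  omega

/-- The chain obtained from `L` by reflecting at the violation `p`. -/
def flipAt (L : ℕ → ℕ → ℕ) (p : ℕ × ℕ) : ℕ → ℕ → ℕ :=
  Function.update L (p.2 + 1) (flip3 (L p.2) (L (p.2 + 1)) (L (p.2 + 2)) p.1)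

theorem flipAt_self (L : ℕ → ℕ → ℕ) (p : ℕ × ℕ) : flipAt L p (p.2 + 1) =
    flip3 (L p.2) (L (p.2 + 1)) (L (p.2 + 2)) p.1 := Function.update_self _ _ _

theorem flipAt_of_ne (L : ℕ → ℕ → ℕ) (p : ℕ × ℕ) {k : ℕ} (hk : k ≠ p.2 + 1) :
    flipAt L p k = L k := Function.update_of_ne hk _ _

theorem sz_flipAt (L : ℕ → ℕ → ℕ) (p : ℕ × ℕ) {i : ℕ} (hi : i ≤ p.1) (k : ℕ) :
    sz i (flipAt L p k) = sz i (L k) := by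
  by_cases hk : k = p.2 + 1
  · rw [hk, flipAt_self, sz_flip3 hi]
  · rw [flipAt_of_ne _ _ hk]

theorem Sel.isCh_flipAt (h : IsCh r m l L) {p : ℕ × ℕ} (hp : Sel L p) :
    IsCh r m l (flipAt L p) := by
  have hk := h.viol_lt hp.viol
  have hF := hp.flippable h
  refine ⟨?_, ?_, ?_⟩
  · rw [flipAt_of_ne _ _ (by omega), h.bot]
  · intro k hkr
    rw [flipAt_of_ne _ _ (by omega), h.top k hkr]
  · intro k
    by_cases h1 : k = p.2
    · subst h1
      rw [flipAt_self, flipAt_of_ne _ _ (by omega)]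
      exact hF.hs_left
    · by_cases h2 : k = p.2 + 1
      · subst h2
        rw [flipAt_self, flipAt_of_ne _ _ (by omega)]
        exact hF.hs_right
      · rw [flipAt_of_ne _ _ h2, flipAt_of_ne _ _ (by omega)]
        exact h.hs k

theorem Sel.flipAt (h : IsCh r m l L) {p : ℕ × ℕ} (hp : Sel L p) : Sel (flipAt L p) p := by
  have hF := hp.flippable h
  refine ⟨?_, ?_, ?_⟩
  · have h1 := hF.flip.viol
    have h2 := hF.flip.le
    rw [Viol, flipAt_self, flipAt_of_ne _ _ (by omega), flipAt_of_ne _ _ (by omega), sz_succ,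
      sz_succ]
    simp only [exc] at h1
    omega
  · intro i hi k
    have := hp.first i hi k
    simp only [Viol] at this ⊢
    rwa [sz_flipAt L p hi, sz_flipAt L p hi, sz_flipAt L p hi.le, sz_flipAt L p hi.le]
  · intro k hk
    have := hp.last k hk
    simp only [Viol] at this ⊢
    rwa [sz_flipAt L p le_rfl, sz_flipAt L p le_rfl, flipAt_of_ne _ _ (by omega),
      flipAt_of_ne _ _ (by omega)]

theorem Sel.flipAt_flipAt (h : IsCh r m l L) {p : ℕ × ℕ} (hp : Sel L p) :
    KroneckerLR.flipAt (KroneckerLR.flipAt L p) p = L := by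
  have hF := hp.flippable h
  ext1 k
  by_cases hk : k = p.2 + 1
  · rw [hk, flipAt_self, flipAt_self, flipAt_of_ne _ _ (by omega), flipAt_of_ne _ _ (by omega),
      hF.flip3_flip3]
  · rw [flipAt_of_ne _ _ hk, flipAt_of_ne _ _ hk]

/-- The content of a chain. -/
def ct (n : ℕ) (L : ℕ → ℕ → ℕ) (k : ℕ) : ℕ := sz n (L (k + 1)) - sz n (L k)

theorem IsCh.sz_mono (h : IsCh r m l L) (i k : ℕ) : sz i (L k) ≤ sz i (L (k + 1)) :=
  KroneckerLR.sz_mono (fun j => (h.hs k j).2) i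

theorem IsCh.hasCt_iff (h : IsCh r m l L) (c : ℕ → ℕ) :
    HasCt n r c L ↔ ∀ k < r, ct n L k = c k := by
  refine forall₂_congr (fun k _ => ?_)
  have := h.sz_mono n k
  rw [ct]
  omega

theorem Sel.ct_flipAt (hl : IsPar n l) (h : IsCh n m l L) {p : ℕ × ℕ} (hp : Sel L p)
    (hk : p.2 + 1 < n) :
    up n (ct n (KroneckerLR.flipAt L p)) =
      up n (ct n L) ∘ Equiv.swap (⟨p.2, by omega⟩ : Fin n) ⟨p.2 + 1, hk⟩ := by
  have hF := (hp.flippable h).sz_flip3 (h.isPar hl _)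
  have hs1 := h.sz_mono n p.2
  have hs2 := h.sz_mono n (p.2 + 1)
  have hs3 := (hp.isCh_flipAt h).sz_mono n p.2
  have hs4 := (hp.isCh_flipAt h).sz_mono n (p.2 + 1)
  rw [flipAt_self, flipAt_of_ne _ _ (by omega)] at hs3 hs4
  have hs5 : sz n (L (p.2 + 1 + 1)) = sz n (L (p.2 + 2)) := rfl
  ext ⟨k, hkn⟩
  simp only [Function.comp]
  by_cases h1 : k = p.2
  · subst h1
    rw [Equiv.swap_apply_left]
    simp only [up, ct]
    rw [flipAt_self, flipAt_of_ne _ _ (by omega)]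
    omega
  · by_cases h2 : k = p.2 + 1
    · subst h2
      rw [Equiv.swap_apply_right]
      simp only [up, ct]
      rw [flipAt_self, flipAt_of_ne _ _ (by omega)]
      omega
    · rw [Equiv.swap_apply_of_ne_of_ne (by simpa [Fin.ext_iff] using h1)
        (by simpa [Fin.ext_iff] using h2)]
      simp only [up, ct]
      rw [flipAt_of_ne _ _ (by omega), flipAt_of_ne _ _ (by omega)]

theorem Lat.isPar_ct (hl : IsPar n l) (h : IsCh n m l L) (hL : Lat L) : IsPar n (ct n L) := by
  constructor
  · apply antitone_nat_of_succ_le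
    intro k
    have h1 := hL n k
    have h2 := h.sz_mono n k
    rw [Viol, (h.isPar hl (k + 1)).sz_eq (Nat.le_succ n),
      (h.isPar hl (k + 2)).sz_eq (Nat.le_succ n)] at h1
    simp only [ct, add_assoc, one_add_one_eq_two]
    omega
  · intro k hk
    rw [ct, h.top k hk, h.top (k + 1) (by omega), Nat.sub_self]

/-- The Littlewood–Richardson coefficient, counted by lattice chains. -/
def lrc (n : ℕ) (m p l : ℕ → ℕ) : ℕ := #{L ∈ chains n n m l | Lat L ∧ HasCt n n p L}

theorem sum_chains_eq_lrc (R : Type*) [CommRing R] [IsDomain R] [CharZero R] {p : ℕ → ℕ}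
    (hl : IsPar n l) (hp : IsPar n p) (m : ℕ → ℕ) :
    ∑ L ∈ chains n n m l, cf (up n (ct n L)) (alt R (up n p)) = (lrc n m p l : R) := by
  rw [← Finset.sum_filter_add_sum_filter_not _ Lat]
  have h1 : ∑ L ∈ chains n n m l with ¬ Lat L, cf (up n (ct n L)) (alt R (up n p)) = 0 := by
    have hsel : ∀ L ∈ {L ∈ chains n n m l | ¬ Lat L}, ∃ q, Sel L q := by
      intro L hL
      rw [mem_filter, mem_chains hl] at hL
      exact hL.1.exists_sel hL.2
    have hneg : ∀ L (hL : L ∈ {L ∈ chains n n m l | ¬ Lat L}),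
        cf (up n (ct n (flipAt L (hsel L hL).choose))) (alt R (up n p)) =
          - cf (up n (ct n L)) (alt R (up n p)) := by
      intro L hL
      have hs := (hsel L hL).choose_spec
      rw [mem_filter, mem_chains hl] at hL
      have hk := hL.1.viol_lt hs.viol
      rw [hs.ct_flipAt hl hL.1 hk, AS_alt, Perm.sign_swap]
      · simp
      · simp
    have hmem : ∀ L (hL : L ∈ {L ∈ chains n n m l | ¬ Lat L}),
        flipAt L (hsel L hL).choose ∈ {L ∈ chains n n m l | ¬ Lat L} := by
      intro L hL
      have hs := (hsel L hL).choose_spec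
      rw [mem_filter, mem_chains hl] at hL
      rw [mem_filter, mem_chains hl]
      exact ⟨hs.isCh_flipAt hL.1, fun h => h _ _ (hs.flipAt hL.1).viol⟩
    refine Finset.sum_involution (fun L hL => flipAt L (hsel L hL).choose) ?_ ?_ hmem ?_
    · intro L hL
      rw [hneg L hL, add_neg_cancel]
    · intro L hL h0 h
      have := hneg L hL
      rw [h] at this
      exact h0 (self_eq_neg.1 this)
    · intro L hL
      have hs := (hsel L hL).choose_spec
      have hs' := (hsel _ (hmem L hL)).choose_spec
      rw [mem_filter, mem_chains hl] at hL
      rw [hs'.unique (hs.flipAt hL.1)]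
      exact hs.flipAt_flipAt hL.1
  rw [h1, add_zero, lrc, ← Finset.filter_filter, Finset.card_filter]
  push_cast
  refine Finset.sum_congr rfl (fun L hL => ?_)
  rw [mem_filter, mem_chains hl] at hL
  have hpar := hL.2.isPar_ct hl hL.1
  rw [cf_alt_up hpar hp, hL.1.hasCt_iff]
  congr 1
  refine propext ⟨fun h k _ => by rw [h], fun h => ?_⟩
  ext k
  by_cases hk : k < n
  · exact (h k hk).symm
  · rw [hp.2 k (by omega), hpar.2 k (by omega)]

end Lattice

end

section

section JacobiTrudi

open MvPolynomial

variable {n : ℕ} {R : Type*} [CommRing R]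

/-- Coefficients of products of complete homogeneous polynomials count matrices with given row
and column sums. -/
theorem cf_prod_hh {ι : Type*} [Fintype ι] (a : Fin n → ℕ) (B : ι → ℕ) :
    cf a (∏ t, hh n R (B t)) =
      (#{M ∈ Fintype.piFinset fun t => piAntidiag (univ : Finset (Fin n)) (B t) |
        ∀ j, ∑ t, M t j = a j} : R) := by
  simp only [hh]
  rw [Finset.prod_univ_sum, cf_sum, Finset.card_filter]
  push_cast
  refine Finset.sum_congr rfl (fun M _ => ?_)
  rw [← xp_sum, cf_xp]
  have : (∑ t, M t = a) ↔ ∀ j, ∑ t, M t j = a j := by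
    rw [funext_iff]
    simp only [Finset.sum_apply]
  simp only [this]

theorem cf_prod_hh_symm (a b : Fin n → ℕ) :
    cf a (∏ t, hh n R (b t)) = cf b (∏ t, hh n R (a t)) := by
  rw [cf_prod_hh, cf_prod_hh]
  congr 1
  refine Finset.card_bij' (fun M _ j i => M i j) (fun M _ j i => M i j) ?_ ?_
    (fun _ _ => rfl) (fun _ _ => rfl)
  all_goals
    intro M hM
    simp only [mem_filter, Fintype.mem_piFinset, mem_piAntidiag] at hM ⊢
    exact ⟨fun j => ⟨hM.2 j, fun _ _ => mem_univ _⟩, fun j => (hM.1 j).1⟩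

/-- Complete homogeneous polynomials of integral degree. -/
def hZ (n : ℕ) (R : Type*) [CommRing R] (z : ℤ) : MvPolynomial (Fin n) R :=
  if 0 ≤ z then hh n R z.toNat else 0

theorem Sy_hZ (z : ℤ) : Sy (hZ n R z) := by
  rw [hZ]
  split_ifs
  · exact Sy_hh _
  · exact Sy_zero

theorem prod_hZ_sub (a b : Fin n → ℕ) :
    ∏ i, hZ n R ((a i : ℤ) - b i) = if b ≤ a then ∏ i, hh n R ((a - b) i) else 0 := by
  split_ifs with h
  · refine Finset.prod_congr rfl (fun i _ => ?_)
    have h1 : b i ≤ a i := h i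
    rw [hZ, if_pos (by omega)]
    congr 1
    rw [Pi.sub_apply]
    omega
  · rw [Pi.le_def, not_forall] at h
    obtain ⟨i, hi⟩ := h
    apply Finset.prod_eq_zero (mem_univ i)
    rw [hZ, if_neg (by omega)]

/-- The skew Schur polynomial, defined by the Jacobi–Trudi determinant. -/
def skewS (n : ℕ) (R : Type*) [CommRing R] (l m : ℕ → ℕ) : MvPolynomial (Fin n) R :=
  ∑ σ : Perm (Fin n), ((Perm.sign σ : ℤ) : MvPolynomial (Fin n) R) *
    ∏ i, hZ n R ((up n l i : ℤ) - up n m (σ i))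

theorem Sy_skewS (l m : ℕ → ℕ) : Sy (skewS n R l m) :=
  Sy.sum _ _ (fun _ _ => (Sy.prod _ _ (fun _ _ => Sy_hZ _)).intCast_mul _)

theorem cf_alt_mul (e f : Fin n → ℕ) (P : MvPolynomial (Fin n) R) :
    cf e (alt R f * P) = ∑ σ : Perm (Fin n), ((Perm.sign σ : ℤ) : R) *
      if f ∘ σ ≤ e then cf (e - f ∘ σ) P else 0 := by
  rw [alt, Finset.sum_mul, cf_sum]
  exact Finset.sum_congr rfl (fun σ _ => by rw [mul_assoc, cf_intCast_mul, cf_xp_mul])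

/-- For a symmetric factor the permutation can be moved to the other side. -/
theorem cf_alt_mul_Sy (e f : Fin n → ℕ) {P : MvPolynomial (Fin n) R} (hP : Sy P) :
    cf e (alt R f * P) = ∑ σ : Perm (Fin n), ((Perm.sign σ : ℤ) : R) *
      if f ≤ e ∘ σ then cf (e ∘ σ - f) P else 0 := by
  rw [cf_alt_mul, ← Equiv.sum_comp (Equiv.inv (Perm (Fin n)))]
  refine Finset.sum_congr rfl (fun σ _ => ?_)
  rw [Equiv.inv_apply, Perm.sign_inv]
  congr 1
  have h1 : f ∘ ⇑σ⁻¹ ≤ e ↔ f ≤ e ∘ σ := by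
    constructor
    · intro h i
      simpa using h (σ i)
    · intro h i
      simpa using h (σ⁻¹ i)
  have h2 : (e - f ∘ ⇑σ⁻¹) ∘ σ = e ∘ σ - f := by
    ext i
    simp
  rw [← h2, hP]
  simp only [h1]

theorem cf_skewS (l m : ℕ → ℕ) (z : Fin n → ℕ) :
    cf z (skewS n R l m) = cf (up n l) (alt R (up n m) * ∏ k, hh n R (z k)) := by
  rw [cf_alt_mul, skewS, cf_sum]
  refine Finset.sum_congr rfl (fun σ _ => ?_)
  rw [cf_intCast_mul]
  congr 1
  have := prod_hZ_sub (R := R) (up n l) (up n m ∘ σ)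
  simp only [Function.comp_apply] at this
  rw [this]
  split_ifs
  · rw [cf_prod_hh_symm]
  · simp

theorem IsPar_zero : IsPar n (fun _ => 0) := ⟨fun _ _ _ => le_rfl, fun _ _ => rfl⟩

section Domain

variable [IsDomain R] [CharZero R] {m l p : ℕ → ℕ}

theorem cf_alt_mul_prod_hh' (hm : IsPar n m) (hl : IsPar n l) (c : Fin n → ℕ) :
    cf (up n l) (alt R (up n m) * ∏ k, hh n R (c k)) =
      (#{L ∈ chains n n m l | ∀ k : Fin n, ct n L k = c k} : R) := by
  have := cf_alt_mul_prod_hh (R := R) hm hl n (fun k => if h : k < n then c ⟨k, h⟩ else 0)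
  rw [Finset.prod_range] at this
  simp only [Fin.is_lt, dif_pos, Fin.eta] at this
  rw [this]
  congr 2
  apply Finset.filter_congr
  intro L hL
  rw [mem_chains hl] at hL
  rw [hL.hasCt_iff]
  constructor
  · intro h k
    have := h k k.2
    rwa [dif_pos k.2] at this
  · intro h k hk
    rw [dif_pos hk]
    exact h ⟨k, hk⟩

theorem sum_sign_card_chains (hl : IsPar n l) (hp : IsPar n p) (m : ℕ → ℕ) :
    (∑ σ : Perm (Fin n), ((Perm.sign σ : ℤ) : R) *
      if up n (fun _ => 0) ≤ up n p ∘ σ then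
        (#{L ∈ chains n n m l | ∀ k : Fin n, ct n L k =
          (up n p ∘ σ - up n (fun _ => 0)) k} : R) else 0) = (lrc n m p l : R) := by
  rw [← sum_chains_eq_lrc R hl hp m]
  simp only [cf_alt]
  rw [Finset.sum_comm]
  refine Finset.sum_congr rfl (fun σ _ => ?_)
  rw [← Finset.mul_sum]
  congr 1
  rw [Finset.card_filter]
  have key : ∀ L : ℕ → ℕ → ℕ, up n p ∘ σ = up n (ct n L) ↔ (up n (fun _ => 0) ≤ up n p ∘ σ ∧
      ∀ k : Fin n, ct n L k = (up n p ∘ σ - up n (fun _ => 0)) k) := by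
    intro L
    constructor
    · intro h
      rw [h]
      exact ⟨fun k => by simp [up], fun k => by simp [up]⟩
    · rintro ⟨h1, h2⟩
      ext k
      have h3 := h1 k
      have h4 := h2 k
      simp only [up, Pi.sub_apply, Function.comp] at h3 h4 ⊢
      omega
  simp only [key]
  split_ifs with h
  · simp [h]
  · simp [h]

theorem cf_alt_mul_S (hm : IsPar n m) (hl : IsPar n l) (hp : IsPar n p) :
    cf (up n l) (alt R (up n m) * skewS n R p (fun _ => 0)) = (lrc n m p l : R) := by
  rw [← sum_sign_card_chains hl hp m, skewS, Finset.mul_sum, cf_sum,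
    ← Equiv.sum_comp (Equiv.inv (Perm (Fin n)))]
  refine Finset.sum_congr rfl (fun σ _ => ?_)
  rw [mul_left_comm, cf_intCast_mul, Equiv.inv_apply, Perm.sign_inv]
  congr 1
  rw [← Equiv.prod_comp σ]
  have := prod_hZ_sub (R := R) (up n p ∘ σ) (up n (fun _ => 0))
  simp only [Function.comp_apply] at this
  simp only [Equiv.Perm.inv_def, Equiv.symm_apply_apply]
  rw [this]
  split_ifs
  · rw [← cf_alt_mul_prod_hh' hm hl]
  · simp

theorem cf_alt_zero_mul_skewS (hm : IsPar n m) (hl : IsPar n l) (hp : IsPar n p) :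
    cf (up n p) (alt R (up n (fun _ => 0)) * skewS n R l m) = (lrc n m p l : R) := by
  rw [← sum_sign_card_chains hl hp m, cf_alt_mul_Sy _ _ (Sy_skewS _ _)]
  refine Finset.sum_congr rfl (fun σ _ => ?_)
  rw [cf_skewS, cf_alt_mul_prod_hh' hm hl]

end Domain

variable {m l p : ℕ → ℕ} {L : ℕ → ℕ → ℕ} {r : ℕ}

/-- In a lattice chain the row `i` is constant from level `i + 1` on. -/
theorem Lat.eq_of_lt (h : ∀ k i, L k i ≤ L (k + 1) i) (hL : Lat L) (i : ℕ) :
    ∀ k, i < k → L (k + 1) i = L k i := by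
  induction i using Nat.strong_induction_on with
  | _ i ih =>
    intro k hk
    obtain ⟨k, rfl⟩ : ∃ j, k = j + 1 := ⟨k - 1, by omega⟩
    have h1 : sz i (L (k + 1)) = sz i (L k) := sz_congr (fun j hj => ih j hj k (by omega))
    have h2 : sz i (L (k + 2)) = sz i (L (k + 1)) :=
      sz_congr (fun j hj => ih j hj (k + 1) (by omega))
    have h3 := hL i k
    have h4 := h (k + 1) i
    rw [Viol, sz_succ, sz_succ] at h3
    have h5 : L (k + 1 + 1) i = L (k + 2) i := rfl
    omega

theorem Lat.eq_top (h : IsCh r m l L) (hL : Lat L) {i k : ℕ} (hk : i < k) : L k i = l i := by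
  have : ∀ d, L (k + d) i = L k i := by
    intro d
    induction d with
    | zero => rfl
    | succ d ih => rw [← ih, ← add_assoc, hL.eq_of_lt (fun k i => (h.hs k i).2) i _ (by omega)]
  rw [← this r, h.top _ (by omega)]

theorem IsCh.eq_zero (h : IsCh r (fun _ => 0) l L) (k : ℕ) : ∀ i, k ≤ i → L k i = 0 := by
  induction k with
  | zero => intro i _; rw [h.bot]
  | succ k ih =>
    intro i hi
    obtain ⟨i, rfl⟩ : ∃ j, i = j + 1 := ⟨i - 1, by omega⟩
    have h1 := (h.hs k i).1
    have h2 := ih i (by omega)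
    omega

/-- The chain `L k = (l 0, …, l (k - 1), 0, …)`. -/
def canon (l : ℕ → ℕ) (k i : ℕ) : ℕ := if i < k then l i else 0

theorem isCh_canon (hl : IsPar n l) : IsCh n (fun _ => 0) l (canon l) := by
  refine ⟨?_, ?_, ?_⟩
  · ext i
    simp [canon]
  · intro k hk
    ext i
    rw [canon]
    split_ifs with h
    · rfl
    · rw [hl.2 i (by omega)]
  · intro k i
    have := hl.1 (Nat.le_succ i)
    simp only [canon]
    simp only [Nat.succ_eq_add_one] at this
    split_ifs <;> omega

theorem sz_canon (i k : ℕ) : sz i (canon l k) = sz (min i k) l := by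
  induction i with
  | zero => simp [sz]
  | succ i ih =>
    rw [sz_succ, ih, canon]
    split_ifs with h
    · rw [min_eq_left (by omega), min_eq_left (by omega), sz_succ]
    · rw [min_eq_right (by omega), min_eq_right (by omega), add_zero]

theorem lat_canon (hl : Antitone l) : Lat (canon l) := by
  intro i k
  simp only [Viol, sz_canon]
  rcases lt_trichotomy i (k + 1) with h | h | h
  · rw [min_eq_left (by omega), min_eq_left (by omega), min_eq_left (by omega),
      min_eq_left (by omega)]
    omega
  · subst h
    have := hl (Nat.le_succ k)
    rw [min_eq_right (by omega), min_eq_left (by omega), min_eq_left (by omega),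
      min_eq_right (by omega)]
    simp only [Nat.succ_eq_add_one, sz_succ] at this ⊢
    omega
  · have := hl (Nat.le_succ k)
    rw [min_eq_right (by omega), min_eq_right (by omega), min_eq_right (by omega),
      min_eq_right (by omega)]
    simp only [Nat.succ_eq_add_one, sz_succ] at this ⊢
    omega

theorem hasCt_canon : HasCt n n l (canon l) := by
  intro k hk
  rw [sz_canon, sz_canon, min_eq_right (by omega), min_eq_right (by omega), sz_succ]

theorem lrc_zero (hl : IsPar n l) (hp : IsPar n p) :
    lrc n (fun _ => 0) p l = if l = p then 1 else 0 := by
  have huniq : ∀ L, IsCh n (fun _ => 0) l L → Lat L → L = canon l := by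
    intro L h hL
    ext k i
    rw [canon]
    split_ifs with hi
    · exact hL.eq_top h hi
    · exact h.eq_zero k i (by omega)
  have hcp : HasCt n n p (canon l) ↔ l = p := by
    constructor
    · intro h
      ext k
      by_cases hk : k < n
      · have h1 := h k hk
        have h2 := hasCt_canon (l := l) k hk
        omega
      · rw [hl.2 k (by omega), hp.2 k (by omega)]
    · rintro rfl
      exact hasCt_canon
  rw [lrc]
  split_ifs with h
  · rw [Finset.card_eq_one]
    refine ⟨canon l, ?_⟩
    ext L
    rw [mem_filter, mem_chains hl, mem_singleton]
    constructor
    · rintro ⟨h1, h2, -⟩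
      exact huniq L h1 h2
    · rintro rfl
      exact ⟨isCh_canon hl, lat_canon hl.1, hcp.2 h⟩
  · rw [Finset.card_eq_zero, Finset.eq_empty_iff_forall_notMem]
    intro L hL
    rw [mem_filter, mem_chains hl] at hL
    have := huniq L hL.1 hL.2.1
    subst this
    exact h (hcp.1 hL.2.2)

/-- The partitions of `N` with at most `n` parts. -/
def parts (n N : ℕ) : Finset (ℕ → ℕ) :=
  {l ∈ below n (fun i => if i < n then N else 0) | sz n l = N}

theorem mem_parts {N : ℕ} : l ∈ parts n N ↔ IsPar n l ∧ sz n l = N := by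
  have hpar : IsPar n (fun i => if i < n then N else 0) := by
    refine ⟨fun i j hij => ?_, fun i hi => if_neg (by omega)⟩
    dsimp only
    split_ifs <;> omega
  rw [parts, mem_filter, mem_below hpar]
  constructor
  · rintro ⟨⟨h1, -⟩, h2⟩
    exact ⟨h1, h2⟩
  · rintro ⟨h1, h2⟩
    refine ⟨⟨h1, fun i => ?_⟩, h2⟩
    dsimp only
    split_ifs with hi
    · rw [← h2]
      exact Finset.single_le_sum (fun _ _ => Nat.zero_le _) (Finset.mem_range.2 hi)
    · exact (h1.2 i (by omega)).le

theorem HasCt.sz_eq (h : IsCh r m l L) {c : ℕ → ℕ} (hc : HasCt n r c L) :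
    sz n l = sz n m + sz r c := by
  have : ∀ k ≤ r, sz n (L k) = sz n m + sz k c := by
    intro k
    induction k with
    | zero => intro _; rw [h.bot]; simp [sz]
    | succ k ih =>
      intro hk
      rw [hc k (by omega), ih (by omega), sz_succ]
      ring
  rw [← this r le_rfl, h.top r le_rfl]

theorem lrc_ne_zero (hl : IsPar n l) (h : lrc n m p l ≠ 0) :
    m ≤ l ∧ sz n l = sz n m + sz n p := by
  rw [lrc, Finset.card_ne_zero] at h
  obtain ⟨L, hL⟩ := h
  rw [mem_filter, mem_chains hl] at hL
  refine ⟨?_, hL.2.2.sz_eq hL.1⟩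
  rw [← hL.1.bot]
  exact hL.1.le 0

section Domain

variable [IsDomain R] [CharZero R]

theorem alt_zero_ne_zero {R : Type*} [CommRing R] [CharZero R] : alt R (up n (fun _ => 0)) ≠ 0 := by
  intro h
  have := cf_alt_up (R := R) (n := n) IsPar_zero IsPar_zero
  rw [h, cf_zero, if_pos rfl] at this
  exact zero_ne_one this

theorem alt_mul_S (hp : IsPar n p) :
    alt R (up n (fun _ => 0)) * skewS n R p (fun _ => 0) = alt R (up n p) := by
  apply AS.ext ((AS_alt _).mul_Sy (Sy_skewS _ _)) (AS_alt _)
  intro l hl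
  rw [cf_alt_mul_S IsPar_zero hl hp, cf_alt_up hl hp, lrc_zero hl hp]
  push_cast
  simp only [eq_comm]

theorem skewS_eq_sum (hm : IsPar n m) (hl : IsPar n l) {N : ℕ} (h : sz n l = sz n m + N) :
    skewS n R l m = ∑ p ∈ parts n N, C (lrc n m p l : R) * skewS n R p (fun _ => 0) := by
  apply mul_left_cancel₀ (alt_zero_ne_zero (R := R) (n := n))
  have hAS := (AS_alt (R := R) (up n (fun _ => 0))).mul_Sy (Sy_skewS l m)
  rw [hAS.expand (parts n N) (fun l hl => (mem_parts.1 hl).1), Finset.mul_sum]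
  · refine Finset.sum_congr rfl (fun p hp => ?_)
    have := (mem_parts.1 hp).1
    rw [cf_alt_zero_mul_skewS hm hl this, ← alt_mul_S this]
    ring
  · intro p hp hpN
    rw [cf_alt_zero_mul_skewS hm hl hp, Nat.cast_eq_zero]
    by_contra hne
    have := (lrc_ne_zero hl hne).2
    exact hpN (mem_parts.2 ⟨hp, by omega⟩)

/-- Multiplication of an alternant by a skew Schur polynomial. -/
theorem cf_alt_mul_skewS {a b : ℕ → ℕ} (hb : IsPar n b) (ha : IsPar n a) (hm : IsPar n m)
    (hl : IsPar n l) {N : ℕ} (h : sz n l = sz n m + N) :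
    cf (up n a) (alt R (up n b) * skewS n R l m) =
      ∑ p ∈ parts n N, (lrc n b p a : R) * (lrc n m p l : R) := by
  rw [skewS_eq_sum hm hl h, Finset.mul_sum, cf_sum]
  refine Finset.sum_congr rfl (fun p hp => ?_)
  rw [mul_left_comm, cf_C_mul, cf_alt_mul_S hb ha (mem_parts.1 hp).1, mul_comm]

end Domain

end JacobiTrudi

end

section

section TwoAlphabets

open MvPolynomial

variable {n : ℕ}

/-- Polynomials in `n` variables. -/
abbrev Px (n : ℕ) : Type := MvPolynomial (Fin n) ℚ

/-- The complete homogeneous polynomial in the products of two sets of `n` variables. -/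
def HH (n m : ℕ) : MvPolynomial (Fin n) (Px n) :=
  ∑ b ∈ piAntidiag univ m, C (∏ j, hh n ℚ (b j)) * xp (Px n) b

theorem cf_HH (b : Fin n → ℕ) (m : ℕ) :
    cf b (HH n m) = if ∑ i, b i = m then ∏ j, hh n ℚ (b j) else 0 := by
  rw [HH, cf_sum]
  simp only [cf_C_mul, cf_xp, mul_ite, mul_one, mul_zero]
  rw [Finset.sum_ite_eq']
  simp

theorem Sy_HH (m : ℕ) : Sy (HH n m) := by
  intro σ e
  rw [cf_HH, cf_HH]
  simp only [Function.comp_apply, Equiv.sum_comp σ e, Equiv.prod_comp σ (fun i => hh n ℚ (e i))]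

variable {l m : ℕ → ℕ}

theorem cf_alt_mul_HH (N : ℕ) :
    cf (up n l) (alt (Px n) (up n m) * HH n N) =
      if sz n l = sz n m + N then skewS n ℚ l m else 0 := by
  rw [cf_alt_mul, skewS]
  have key : ∀ σ : Perm (Fin n), (if up n m ∘ σ ≤ up n l then
      cf (up n l - up n m ∘ σ) (HH n N) else 0) = if sz n l = sz n m + N then
        ∏ i, hZ n ℚ ((up n l i : ℤ) - up n m (σ i)) else 0 := by
    intro σ
    have := prod_hZ_sub (R := ℚ) (up n l) (up n m ∘ σ)
    simp only [Function.comp_apply] at this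
    rw [this]
    by_cases h : up n m ∘ σ ≤ up n l
    · rw [if_pos h, if_pos h, cf_HH]
      have h1 : ∑ i, (up n l - up n m ∘ σ) i + ∑ i, up n m i = ∑ i, up n l i := by
        rw [← Equiv.sum_comp σ (up n m), ← Finset.sum_add_distrib]
        exact Finset.sum_congr rfl (fun i _ => Nat.sub_add_cancel (h i))
      rw [sum_up, sum_up] at h1
      have h2 : (∑ i, (up n l - up n m ∘ σ) i = N) ↔ sz n l = sz n m + N := by omega
      simp only [h2]
    · rw [if_neg h, if_neg h, ite_self]
  simp only [key]
  split_ifs <;> simp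

/-- All coefficients are symmetric. -/
def SyC (W : MvPolynomial (Fin n) (Px n)) : Prop :=
  ∀ σ : Perm (Fin n), MvPolynomial.map (rename (R := ℚ) σ : Px n →+* Px n) W = W

theorem SyC.mul {V W : MvPolynomial (Fin n) (Px n)} (hV : SyC V) (hW : SyC W) : SyC (V * W) := by
  intro σ
  rw [map_mul, hV, hW]

theorem SyC.prod {ι : Type*} (s : Finset ι) (P : ι → MvPolynomial (Fin n) (Px n))
    (h : ∀ i ∈ s, SyC (P i)) : SyC (∏ i ∈ s, P i) :=
  Finset.prod_induction P SyC (fun _ _ => SyC.mul) (fun _ => map_one _) h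

theorem SyC.cf {W : MvPolynomial (Fin n) (Px n)} (hW : SyC W) (e : Fin n → ℕ) :
    Sy (cf e W) := by
  rw [Sy_iff]
  intro σ
  have := congrArg (KroneckerLR.cf e) (hW σ)
  rw [KroneckerLR.cf, coeff_map] at this
  exact this

theorem SyC_of_cf {W : MvPolynomial (Fin n) (Px n)} (h : ∀ e, Sy (cf e W)) : SyC W := by
  intro σ
  apply ext_cf
  intro e
  rw [KroneckerLR.cf, coeff_map]
  exact (Sy_iff.1 (h e)) σ

theorem SyC_alt (e : Fin n → ℕ) : SyC (alt (Px n) e) := by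
  apply SyC_of_cf
  intro f
  rw [cf_alt]
  refine Sy.sum _ _ (fun σ _ => Sy.intCast_mul _ ?_)
  split_ifs
  · exact Sy_one
  · exact Sy_zero

theorem SyC_HH (m : ℕ) : SyC (HH n m) := by
  apply SyC_of_cf
  intro f
  rw [cf_HH]
  split_ifs
  · exact Sy.prod _ _ (fun _ _ => Sy_hh _)
  · exact Sy_zero

/-- The number of pairs of multitableaux of type `v`, computed by recursion on the number of
steps. -/
def lrn (n : ℕ) (v : ℕ → ℕ) : ℕ → (ℕ → ℕ) → (ℕ → ℕ) → ℕ
  | 0, a, b => if a = (fun _ => 0) ∧ b = (fun _ => 0) then 1 else 0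
  | r + 1, a, b => ∑ b' ∈ below n b, ∑ a' ∈ below n a,
      lrn n v r a' b' * ∑ p ∈ parts n (v r), lrc n a' p a * lrc n b' p b

theorem cf_cf_prod_HH (v : ℕ → ℕ) (r : ℕ) {a b : ℕ → ℕ} (ha : IsPar n a) (hb : IsPar n b) :
    cf (up n a) (cf (up n b) (C (alt ℚ (up n (fun _ => 0))) * (alt (Px n) (up n (fun _ => 0)) *
      ∏ k ∈ range r, HH n (v k)))) = (lrn n v r a b : ℚ) := by
  induction r generalizing a b with
  | zero =>
    rw [cf_C_mul, Finset.prod_range_zero, mul_one, cf_alt_up hb IsPar_zero, lrn, mul_ite, mul_one,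
      mul_zero]
    split_ifs with h1 h2 h2
    · rw [cf_alt_up ha IsPar_zero, if_pos h2.1.symm, Nat.cast_one]
    · rw [cf_alt_up ha IsPar_zero, if_neg, Nat.cast_zero]
      intro h
      exact h2 ⟨h.symm, h1.symm⟩
    · exact absurd h2.2.symm h1
    · simp
  | succ r ih =>
    set W := alt (Px n) (up n (fun _ => 0)) * ∏ k ∈ range r, HH n (v k) with hW
    have hWS : SyC W := (SyC_alt _).mul (SyC.prod _ _ (fun _ _ => SyC_HH _))
    have hWA : AS W := (AS_alt _).mul_Sy (Sy.prod _ _ (fun _ _ => Sy_HH _))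
    rw [Finset.prod_range_succ, ← mul_assoc, ← mul_assoc, mul_assoc (C _) (alt _ _), ← hW]
    have hstep : ∀ l, IsPar n l → ∀ m, IsPar n m → cf (up n a) (cf (up n m)
        (C (alt ℚ (up n (fun _ => 0))) * W) * cf (up n l) (alt (Px n) (up n m) * HH n (v r))) =
        if sz n l = sz n m + v r then ∑ a' ∈ below n a, (lrn n v r a' m : ℚ) *
          ∑ p ∈ parts n (v r), (lrc n a' p a : ℚ) * (lrc n m p l : ℚ) else 0 := by
      intro l hl m hm
      rw [cf_alt_mul_HH]
      split_ifs with h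
      · have hAS : AS (cf (up n m) (C (alt ℚ (up n (fun _ => 0))) * W)) := by
          rw [cf_C_mul]
          exact (AS_alt _).mul_Sy (hWS.cf _)
        rw [hAS.cf_mul _ _ (below n a) (fun l hl => ((mem_below ha).1 hl).1)]
        · refine Finset.sum_congr rfl (fun a' ha' => ?_)
          have := ((mem_below ha).1 ha').1
          rw [cf_alt_mul_skewS this ha hm hl h, ih this hm]
        · intro a' ha' ha'a
          rw [cf_alt_mul_skewS ha' ha hm hl h, Finset.sum_eq_zero, mul_zero]
          intro p _
          by_cases h0 : lrc n a' p a = 0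
          · rw [h0]; simp
          · exact absurd ((mem_below ha).2 ⟨ha', (lrc_ne_zero ha h0).1⟩) ha'a
      · rw [mul_zero, cf_zero]
    rw [(hWA.C_mul _).cf_mul _ _ (below n b) (fun l hl => ((mem_below hb).1 hl).1), cf_sum]
    · rw [lrn]
      push_cast
      refine Finset.sum_congr rfl (fun b' hb' => ?_)
      have hb'' := ((mem_below hb).1 hb').1
      rw [hstep b hb b' hb'']
      split_ifs with h
      · rfl
      · symm
        apply Finset.sum_eq_zero
        intro a' _
        rw [Finset.sum_eq_zero, mul_zero]
        intro p hp
        by_cases h0 : lrc n b' p b = 0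
        · rw [h0]; simp
        · have := (lrc_ne_zero hb h0).2
          rw [(mem_parts.1 hp).2] at this
          exact absurd this h
    · intro m hm hmb
      rw [cf_alt_mul_HH]
      split_ifs with h
      · rw [skewS_eq_sum hm hb h, Finset.sum_eq_zero, mul_zero]
        intro p _
        by_cases h0 : lrc n m p b = 0
        · rw [h0]; simp
        · exact absurd ((mem_below hb).2 ⟨hm, (lrc_ne_zero hb h0).1⟩) hmb
      · rw [mul_zero]

/-- Coefficients of products of the `HH` count three-dimensional arrays. -/
theorem cf_cf_prod_HH_eq_card (a b c : Fin n → ℕ) :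
    cf a (cf b (∏ k, HH n (c k))) =
      (Nat.card {A : Fin n × Fin n × Fin n → ℕ //
        (∀ i, ∑ j, ∑ k, A (i, j, k) = a i) ∧ (∀ j, ∑ i, ∑ k, A (i, j, k) = b j) ∧
        (∀ k, ∑ i, ∑ j, A (i, j, k) = c k)} : ℚ) := by
  set F : Finset (Fin n → Fin n → ℕ) :=
    {M ∈ Fintype.piFinset fun k => piAntidiag (univ : Finset (Fin n)) (c k) |
      ∀ j, ∑ k, M k j = b j} with hF
  set G : (Fin n → Fin n → ℕ) → Finset (Fin n × Fin n → Fin n → ℕ) := fun M =>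
    {N ∈ Fintype.piFinset fun t : Fin n × Fin n => piAntidiag (univ : Finset (Fin n)) (M t.1 t.2) |
      ∀ i, ∑ t, N t i = a i} with hG
  have h1 : cf b (∏ k, HH n (c k)) = ∑ M ∈ F, ∏ t : Fin n × Fin n, hh n ℚ (M t.1 t.2) := by
    simp only [HH]
    rw [Finset.prod_univ_sum, cf_sum, hF, Finset.sum_filter]
    refine Finset.sum_congr rfl (fun M _ => ?_)
    rw [Finset.prod_mul_distrib, ← xp_sum, ← map_prod, cf_C_mul, cf_xp, Fintype.prod_prod_type]
    have : (∑ t, M t = b) ↔ ∀ j, ∑ t, M t j = b j := by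
      rw [funext_iff]
      simp only [Finset.sum_apply]
    simp only [this, mul_ite, mul_one, mul_zero]
  have h2 : cf a (cf b (∏ k, HH n (c k))) = (#(F.sigma G) : ℚ) := by
    rw [h1, cf_sum, Finset.card_sigma]
    push_cast
    refine Finset.sum_congr rfl (fun M _ => ?_)
    rw [cf_prod_hh]
    congr!
  rw [h2, ← Nat.card_eq_finsetCard]
  congr 1
  refine Nat.card_congr ⟨fun s => ⟨fun q => s.1.2 (q.2.2, q.2.1) q.1, ?_⟩,
    fun A => ⟨⟨fun k j => ∑ i, A.1 (i, j, k), fun t i => A.1 (i, t.2, t.1)⟩, ?_⟩, ?_, ?_⟩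
  · obtain ⟨⟨M, N⟩, hs⟩ := s
    simp only [hF, hG, mem_sigma, mem_filter, Fintype.mem_piFinset, mem_piAntidiag,
      Prod.forall] at hs
    obtain ⟨⟨ha, hb⟩, hc, hd⟩ := hs
    refine ⟨fun i => ?_, fun j => ?_, fun k => ?_⟩
    · rw [← hd i, Fintype.sum_prod_type, Finset.sum_comm]
    · rw [← hb j, Finset.sum_comm]
      exact Finset.sum_congr rfl (fun k _ => (hc k j).1)
    · rw [← (ha k).1, Finset.sum_comm]
      exact Finset.sum_congr rfl (fun j _ => (hc k j).1)
  · obtain ⟨A, ha, hb, hc⟩ := A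
    simp only [hF, hG, mem_sigma, mem_filter, Fintype.mem_piFinset, mem_piAntidiag,
      Prod.forall]
    refine ⟨⟨fun k => ⟨?_, fun _ _ => mem_univ _⟩, fun j => ?_⟩,
      fun k j => ⟨trivial, fun _ _ => mem_univ _⟩, fun i => ?_⟩
    · rw [← hc k, Finset.sum_comm]
    · rw [← hb j, Finset.sum_comm]
    · rw [← ha i, Fintype.sum_prod_type, Finset.sum_comm]
  · rintro ⟨⟨M, N⟩, hs⟩
    simp only [hF, hG, mem_sigma, mem_filter, Fintype.mem_piFinset, mem_piAntidiag,
      Prod.forall] at hs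
    apply Subtype.ext
    refine Sigma.ext ?_ HEq.rfl
    ext k j
    exact (hs.2.1 k j).1
  · rintro ⟨A, hA⟩
    rfl

theorem cf_prod_hh_eq_card (a c : Fin n → ℕ) :
    cf a (∏ k, hh n ℚ (c k)) =
      (Nat.card {A : Fin n × Fin n → ℕ //
        (∀ i, ∑ k, A (i, k) = a i) ∧ (∀ k, ∑ i, A (i, k) = c k)} : ℚ) := by
  rw [cf_prod_hh, ← Nat.card_eq_finsetCard]
  congr 1
  refine Nat.card_congr ⟨fun M => ⟨fun q => M.1 q.2 q.1, ?_⟩,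
    fun A => ⟨fun k i => A.1 (i, k), ?_⟩, fun _ => rfl, fun _ => rfl⟩
  · obtain ⟨M, hM⟩ := M
    simp only [mem_filter, Fintype.mem_piFinset, mem_piAntidiag] at hM
    exact ⟨hM.2, fun k => (hM.1 k).1⟩
  · obtain ⟨A, ha, hc⟩ := A
    simp only [mem_filter, Fintype.mem_piFinset, mem_piAntidiag]
    exact ⟨fun k => ⟨hc k, fun _ _ => mem_univ _⟩, ha⟩

end TwoAlphabets

end

section

section Tableaux

variable {n : ℕ} {a b : ℕ → ℕ} {T : ℕ → ℕ → ℕ} {L : ℕ → ℕ → ℕ}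

theorem natCard_strip (n : ℕ) (u w : ℕ → ℕ) (hw : ∀ i, n ≤ i → w i = 0) :
    Nat.card {p : ℕ × ℕ // u p.1 ≤ p.2 ∧ p.2 < w p.1} = ∑ i ∈ range n, (w i - u i) := by
  have h1 : ∑ i ∈ range n, (w i - u i) = #((range n).sigma fun i => Ico (u i) (w i)) := by
    rw [Finset.card_sigma]
    exact Finset.sum_congr rfl (fun i _ => (Nat.card_Ico _ _).symm)
  rw [h1, ← Nat.card_eq_finsetCard]
  refine Nat.card_congr ⟨fun p => ⟨⟨p.1.1, p.1.2⟩, ?_⟩, fun s => ⟨(s.1.1, s.1.2), ?_⟩,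
    fun _ => rfl, fun _ => rfl⟩
  · obtain ⟨⟨i, j⟩, h⟩ := p
    simp only [mem_sigma, mem_range, mem_Ico] at h ⊢
    refine ⟨?_, h⟩
    by_contra hi
    rw [hw i (by omega)] at h
    omega
  · obtain ⟨⟨i, j⟩, h⟩ := s
    simp only [mem_sigma, mem_range, mem_Ico] at h ⊢
    exact h.2

theorem sum_sub_eq (n : ℕ) {u w : ℕ → ℕ} (h : u ≤ w) :
    ∑ i ∈ range n, (w i - u i) = sz n w - sz n u := by
  rw [sz, sz, Finset.sum_tsub_distrib _ (fun i _ => h i)]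

theorem skewSize_eq (ha : IsPar n a) (h : b ≤ a) : skewSize a b = sz n a - sz n b := by
  rw [skewSize, natCard_strip n b a ha.2, sum_sub_eq n h]

/-- The filling `T` of `a / b` corresponds to the chain `L`: the entries of `T` smaller than `k`
fill the shape `L k / b`. -/
structure Cor (a b : ℕ → ℕ) (T L : ℕ → ℕ → ℕ) : Prop where
  zero : ∀ i j, ¬(b i ≤ j ∧ j < a i) → T i j = 0
  iff : ∀ i j, b i ≤ j → j < a i → ∀ k, T i j < k ↔ j < L k i
  le : ∀ k, b ≤ L k ∧ L k ≤ a

theorem Cor.mono (h : Cor a b T L) (k i : ℕ) : L k i ≤ L (k + 1) i := by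
  by_contra hlt
  have h1 : L k i ≤ a i := (h.le k).2 i
  have h2 : b i ≤ L (k + 1) i := (h.le (k + 1)).1 i
  have h3 := h.iff i (L (k + 1) i) h2 (by omega)
  have h4 := (h3 k).2 (by omega)
  have h5 := (h3 (k + 1)).1 (by omega)
  omega

theorem Cor.eq_iff (h : Cor a b T L) (i j k : ℕ) :
    (b i ≤ j ∧ j < a i ∧ T i j = k) ↔ (L k i ≤ j ∧ j < L (k + 1) i) := by
  have h1 : b i ≤ L k i := (h.le k).1 i
  have h2 : L (k + 1) i ≤ a i := (h.le (k + 1)).2 i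
  constructor
  · rintro ⟨h3, h4, h5⟩
    have h6 := h.iff i j h3 h4 k
    have h7 := h.iff i j h3 h4 (k + 1)
    omega
  · rintro ⟨h3, h4⟩
    have h6 := h.iff i j (by omega) (by omega) k
    have h7 := h.iff i j (by omega) (by omega) (k + 1)
    omega

theorem Cor.skewContent (ha : IsPar n a) (h : Cor a b T L) (k : ℕ) :
    skewContent a b T k = ct n L k := by
  rw [_root_.skewContent]
  simp only [h.eq_iff]
  rw [natCard_strip n (L k) (L (k + 1)), sum_sub_eq n (h.mono k), ct]
  intro i hi
  exact Nat.le_zero.1 (((h.le (k + 1)).2 i).trans (ha.2 i hi).le)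

theorem Cor.lrCount (h : Cor a b T L) (i j k : ℕ) :
    lrCount a b T i j k = sz i (L (k + 1)) - sz i (L k) + (L (k + 1) i - max j (L k i)) := by
  rw [_root_.lrCount]
  simp only [h.eq_iff]
  have key : ∀ p : ℕ × ℕ, ((p.1 < i ∨ p.1 = i ∧ j ≤ p.2) ∧ L k p.1 ≤ p.2 ∧ p.2 < L (k + 1) p.1) ↔
      ((if p.1 < i then L k p.1 else max j (L k p.1)) ≤ p.2 ∧
        p.2 < if p.1 < i + 1 then L (k + 1) p.1 else 0) := by
    intro p
    split_ifs <;> omega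
  simp only [key]
  rw [natCard_strip (i + 1) (fun t => if t < i then L k t else max j (L k t))
    (fun t => if t < i + 1 then L (k + 1) t else 0), Finset.sum_range_succ]
  · simp only [lt_irrefl, if_false, Nat.lt_succ_self, if_true]
    rw [← sum_sub_eq i (h.mono k)]
    congr 1
    refine Finset.sum_congr rfl (fun t ht => ?_)
    rw [mem_range] at ht
    rw [if_pos ht, if_pos (by omega)]
  · intro t ht
    exact if_neg (by omega)

theorem Cor.lat_iff (h : Cor a b T L) :
    (∀ i j k, _root_.lrCount a b T i j (k + 1) ≤ _root_.lrCount a b T i j k) ↔ Lat L := by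
  have hm : ∀ i k, sz i (L k) ≤ sz i (L (k + 1)) := fun i k => sz_mono (h.mono k) i
  constructor
  · intro hc i k
    have := hc i (L (k + 1) i) k
    rw [h.lrCount, h.lrCount] at this
    have h1 := hm i k
    have h2 := hm i (k + 1)
    have h3 := h.mono k i
    have h4 := h.mono (k + 1) i
    have h5 : L (k + 1 + 1) = L (k + 2) := rfl
    rw [h5] at this h2 h4
    rw [Viol, sz_succ, sz_succ]
    omega
  · intro hL i j k
    have := hL i k
    rw [h.lrCount, h.lrCount]
    have h1 := hm i k
    have h2 := hm i (k + 1)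
    have h3 := h.mono k i
    have h4 := h.mono (k + 1) i
    have h5 : L (k + 1 + 1) = L (k + 2) := rfl
    rw [h5] at h2 h4 ⊢
    rw [Viol, sz_succ, sz_succ] at this
    omega

theorem Cor.isCh (ha : IsPar n a) (hb : IsPar n b) (h : Cor a b T L) (hT : IsLR a b T) :
    IsCh n b a L := by
  have hL : Lat L := h.lat_iff.1 hT.2.2.2
  refine ⟨?_, ?_, ?_⟩
  · ext i
    have h1 : b i ≤ L 0 i := (h.le 0).1 i
    have h2 : L 0 i ≤ a i := (h.le 0).2 i
    by_contra hne
    have := (h.iff i (b i) le_rfl (by omega) 0).2 (by omega)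
    omega
  · intro k hk
    ext i
    have h1 : L k i ≤ a i := (h.le k).2 i
    by_cases hi : i < n
    · have hconst : ∀ d, L (k + d) i = L k i := by
        intro d
        induction d with
        | zero => rfl
        | succ d ih => rw [← ih, ← add_assoc, hL.eq_of_lt h.mono i _ (by omega)]
      have hb1 : b i ≤ L k i := (h.le k).1 i
      by_contra hne
      have h3 := (h.iff i (a i - 1) (by omega) (by omega) (k + (T i (a i - 1) + 1))).1 (by omega)
      rw [hconst] at h3
      omega
    · rw [ha.2 i (by omega)] at h1 ⊢
      omega
  · intro k i
    refine ⟨?_, h.mono k i⟩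
    by_contra hlt
    have h1 : L (k + 1) (i + 1) ≤ a (i + 1) := (h.le (k + 1)).2 (i + 1)
    have h2 : a (i + 1) ≤ a i := ha.1 (Nat.le_succ i)
    have h3 : b (i + 1) ≤ b i := hb.1 (Nat.le_succ i)
    have h4 : b i ≤ L k i := (h.le k).1 i
    have h5 := hT.2.2.1 i (i + 1) (L k i) (by omega) h4 (by omega) (by omega) (by omega)
    have h6 := (h.iff (i + 1) (L k i) (by omega) (by omega) (k + 1)).2 (by omega)
    have h7 := (h.iff i (L k i) (by omega) (by omega) k).1 (by omega)
    omega

theorem Cor.isLR (ha : IsPar n a) (h : Cor a b T L) (hC : IsCh n b a L) (hL : Lat L) :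
    IsLR a b T := by
  refine ⟨h.zero, ?_, ?_, h.lat_iff.2 hL⟩
  · intro i j₁ j₂ h1 h2 h3
    have h4 := (h.iff i j₂ (by omega) h3 (T i j₂ + 1)).1 (by omega)
    have h5 := (h.iff i j₁ h1 (by omega) (T i j₂ + 1)).2 (by omega)
    omega
  · intro i₁ i₂ j hi h1 h2 h3 h4
    have h5 := (h.iff i₂ j h3 h4 (T i₂ j + 1)).1 (by omega)
    have h6 := (hC.isPar ha (T i₂ j + 1)).1 (show i₁ + 1 ≤ i₂ from hi)
    have h7 := (hC.hs (T i₂ j) i₁).1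
    exact (h.iff i₁ j h1 h2 (T i₂ j)).2 (by omega)

theorem Cor.eq_right {L' : ℕ → ℕ → ℕ} (h : Cor a b T L) (h' : Cor a b T L') : L = L' := by
  ext k i
  have h1 : b i ≤ L k i := (h.le k).1 i
  have h2 : L k i ≤ a i := (h.le k).2 i
  have h3 : b i ≤ L' k i := (h'.le k).1 i
  have h4 : L' k i ≤ a i := (h'.le k).2 i
  rcases lt_trichotomy (L k i) (L' k i) with hlt | heq | hlt
  · have h5 := h.iff i (L k i) h1 (by omega) k
    have h6 := h'.iff i (L k i) h1 (by omega) k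
    omega
  · exact heq
  · have h5 := h.iff i (L' k i) h3 (by omega) k
    have h6 := h'.iff i (L' k i) h3 (by omega) k
    omega

theorem Cor.eq_left {T' : ℕ → ℕ → ℕ} (h : Cor a b T L) (h' : Cor a b T' L) : T = T' := by
  ext i j
  by_cases hj : b i ≤ j ∧ j < a i
  · have h1 := h.iff i j hj.1 hj.2
    have h2 := h'.iff i j hj.1 hj.2
    have h3 := (h2 (T i j + 1)).2 ((h1 (T i j + 1)).1 (by omega))
    have h4 := (h1 (T' i j + 1)).2 ((h2 (T' i j + 1)).1 (by omega))
    omega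
  · rw [h.zero i j hj, h'.zero i j hj]

theorem exists_cor_right (hba : b ≤ a) (hT : IsLR a b T) : ∃ L, Cor a b T L := by
  refine ⟨fun k i => b i + #{j ∈ Ico (b i) (a i) | T i j < k}, hT.1, ?_, fun k => ⟨?_, ?_⟩⟩
  · intro i j h1 h2 k
    constructor
    · intro h
      have hsub : Icc (b i) j ⊆ {j ∈ Ico (b i) (a i) | T i j < k} := by
        intro t ht
        rw [mem_Icc] at ht
        rw [mem_filter, mem_Ico]
        exact ⟨⟨ht.1, by omega⟩, lt_of_le_of_lt (hT.2.1 i t j ht.1 ht.2 h2) h⟩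
      have := Finset.card_le_card hsub
      rw [Nat.card_Icc] at this
      omega
    · intro h
      by_contra hk
      have hsub : {j ∈ Ico (b i) (a i) | T i j < k} ⊆ Ico (b i) j := by
        intro t ht
        rw [mem_filter, mem_Ico] at ht
        rw [mem_Ico]
        refine ⟨ht.1.1, ?_⟩
        by_contra htj
        have := hT.2.1 i j t h1 (by omega) ht.1.2
        omega
      have := Finset.card_le_card hsub
      rw [Nat.card_Ico] at this
      omega
  · intro i
    exact Nat.le_add_right _ _
  · intro i
    have := Finset.card_filter_le (Ico (b i) (a i)) (fun j => T i j < k)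
    rw [Nat.card_Ico] at this
    have h1 : b i ≤ a i := hba i
    dsimp only
    omega

theorem exists_cor_left (hC : IsCh n b a L) : ∃ T, Cor a b T L := by
  refine ⟨fun i j => if b i ≤ j ∧ j < a i then sInf {k | j < L (k + 1) i} else 0, ?_, ?_, ?_⟩
  · intro i j hj
    exact if_neg hj
  · intro i j h1 h2 k
    rw [if_pos ⟨h1, h2⟩]
    have hne : {k | j < L (k + 1) i}.Nonempty := ⟨n, by
      rw [Set.mem_ofPred_eq, hC.top (n + 1) (by omega)]
      exact h2⟩
    constructor
    · intro h
      have h3 : j < L (sInf {k | j < L (k + 1) i} + 1) i := Nat.sInf_mem hne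
      have h4 : L (sInf {k | j < L (k + 1) i} + 1) i ≤ L k i := hC.mono i h
      omega
    · intro h
      rcases k with _ | k
      · rw [hC.bot] at h
        omega
      · have : sInf {k | j < L (k + 1) i} ≤ k := Nat.sInf_le h
        omega
  · intro k
    refine ⟨?_, hC.le k⟩
    intro i
    have := hC.mono i (Nat.zero_le k)
    simp only [hC.bot] at this
    exact this

/-- Littlewood–Richardson tableaux of shape `a / b` correspond to lattice chains. -/
def lrEquiv (ha : IsPar n a) (hb : IsPar n b) (hba : b ≤ a) :
    {T // IsLR a b T} ≃ {L // IsCh n b a L ∧ Lat L} where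
  toFun T := ⟨(exists_cor_right hba T.2).choose, by
    have h := (exists_cor_right hba T.2).choose_spec
    exact ⟨h.isCh ha hb T.2, h.lat_iff.1 T.2.2.2.2⟩⟩
  invFun L := ⟨(exists_cor_left L.2.1).choose,
    (exists_cor_left L.2.1).choose_spec.isLR ha L.2.1 L.2.2⟩
  left_inv T := by
    have h := (exists_cor_right hba T.2).choose_spec
    exact Subtype.ext ((exists_cor_left (h.isCh ha hb T.2)).choose_spec.eq_left h)
  right_inv L := by
    have h := (exists_cor_left L.2.1).choose_spec
    exact Subtype.ext ((exists_cor_right hba (h.isLR ha L.2.1 L.2.2)).choose_spec.eq_right h)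

theorem skewContent_lrEquiv (ha : IsPar n a) (hb : IsPar n b) (hba : b ≤ a)
    (T : {T // IsLR a b T}) : skewContent a b T.1 = ct n (lrEquiv ha hb hba T).1 := by
  ext k
  exact (exists_cor_right hba T.2).choose_spec.skewContent ha k

/-- The pairs of Littlewood–Richardson tableaux of shapes `a / a'` and `b / b'` with equal
contents. -/
def Step (a a' b b' : ℕ → ℕ) : Type :=
  {P : {T // IsLR a a' T} × {T // IsLR b b' T} //
    skewContent a a' P.1.1 = skewContent b b' P.2.1}

theorem finite_isLR (ha : IsPar n a) (hb : IsPar n b) (hba : b ≤ a) : Finite {T // IsLR a b T} := by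
  have : Finite {L // IsCh n b a L ∧ Lat L} := by
    refine Finite.of_injective
      (fun L => (⟨L.1, (mem_chains ha).2 L.2.1⟩ : {L // L ∈ chains n n b a})) ?_
    intro x y h
    simpa [Subtype.ext_iff] using h
  exact Finite.of_equiv _ (lrEquiv ha hb hba).symm

theorem finite_step {a' b' : ℕ → ℕ} (ha : IsPar n a) (ha' : IsPar n a') (haa : a' ≤ a)
    (hb : IsPar n b) (hb' : IsPar n b') (hbb : b' ≤ b) : Finite (Step a a' b b') := by
  have := finite_isLR ha ha' haa
  have := finite_isLR hb hb' hbb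
  exact inferInstanceAs (Finite {P : {T // IsLR a a' T} × {T // IsLR b b' T} //
    skewContent a a' P.1.1 = skewContent b b' P.2.1})

theorem IsCh.hasCt_iff_of_lat {m l p : ℕ → ℕ} (hl : IsPar n l) (hp : IsPar n p)
    (h : IsCh n m l L) (hL : Lat L) : HasCt n n p L ↔ ct n L = p := by
  rw [h.hasCt_iff]
  constructor
  · intro h1
    ext k
    by_cases hk : k < n
    · exact h1 k hk
    · rw [(hL.isPar_ct hl h).2 k (by omega), hp.2 k (by omega)]
  · rintro rfl k _
    rfl

theorem sz_ct_of_isCh {m l : ℕ → ℕ} (h : IsCh n m l L) :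
    sz n (ct n L) + sz n m = sz n l := by
  have key : ∀ r, (∑ k ∈ range r, ct n L k) + sz n (L 0) = sz n (L r) := by
    intro r
    induction r with
    | zero => simp
    | succ r ih =>
      rw [Finset.sum_range_succ]
      have h1 := h.sz_mono n r
      rw [ct]
      omega
  have h1 := key n
  rwa [h.bot, h.top n le_rfl] at h1

theorem card_step {a' b' : ℕ → ℕ} (ha : IsPar n a) (ha' : IsPar n a') (haa : a' ≤ a)
    (hb : IsPar n b) (hb' : IsPar n b') (hbb : b' ≤ b) {v : ℕ} (hva : skewSize a a' = v)
    (hvb : skewSize b b' = v) :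
    Nat.card (Step a a' b b') = ∑ p ∈ parts n v, lrc n a' p a * lrc n b' p b := by
  set A := {L ∈ chains n n a' a | Lat L} with hA
  set B := {L ∈ chains n n b' b | Lat L} with hB
  have hAm : ∀ L, L ∈ A ↔ IsCh n a' a L ∧ Lat L := fun L => by rw [hA, mem_filter, mem_chains ha]
  have hBm : ∀ L, L ∈ B ↔ IsCh n b' b L ∧ Lat L := fun L => by rw [hB, mem_filter, mem_chains hb]
  have h1 : Nat.card (Step a a' b b') = #{x ∈ A ×ˢ B | ct n x.1 = ct n x.2} := by
    rw [← Nat.card_eq_finsetCard]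
    refine Nat.card_congr (((((lrEquiv ha ha' haa).prodCongr
      (lrEquiv hb hb' hbb)).subtypeEquiv (q := fun P => ct n P.1.1 = ct n P.2.1) ?_)).trans
      ⟨fun P => ⟨(P.1.1.1, P.1.2.1), ?_⟩, fun x => ⟨(⟨x.1.1, ?_⟩, ⟨x.1.2, ?_⟩), ?_⟩,
        fun _ => rfl, fun _ => rfl⟩)
    · rintro ⟨T, T'⟩
      rw [skewContent_lrEquiv ha ha' haa T, skewContent_lrEquiv hb hb' hbb T']
      rfl
    · rw [mem_filter, mem_product, hAm, hBm]
      exact ⟨⟨P.1.1.2, P.1.2.2⟩, P.2⟩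
    · have := x.2
      rw [mem_filter, mem_product, hAm, hBm] at this
      exact this.1.1
    · have := x.2
      rw [mem_filter, mem_product, hAm, hBm] at this
      exact this.1.2
    · have := x.2
      rw [mem_filter, mem_product, hAm, hBm] at this
      exact this.2
  rw [h1, Finset.card_eq_sum_card_fiberwise (f := fun x => ct n x.1) (t := parts n v)]
  · refine Finset.sum_congr rfl (fun p hp => ?_)
    rw [mem_parts] at hp
    rw [lrc, lrc, ← Finset.card_product]
    congr 1
    ext ⟨x, y⟩
    simp only [mem_filter, mem_product, hAm, hBm, mem_chains ha, mem_chains hb]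
    constructor
    · rintro ⟨⟨⟨hx, hy⟩, hxy⟩, hxp⟩
      refine ⟨⟨hx.1, hx.2, ?_⟩, ⟨hy.1, hy.2, ?_⟩⟩
      · exact (hx.1.hasCt_iff_of_lat ha hp.1 hx.2).2 hxp
      · exact (hy.1.hasCt_iff_of_lat hb hp.1 hy.2).2 (hxy.symm.trans hxp)
    · rintro ⟨⟨hx, hx', hx2⟩, ⟨hy, hy', hy2⟩⟩
      rw [hx.hasCt_iff_of_lat ha hp.1 hx'] at hx2
      rw [hy.hasCt_iff_of_lat hb hp.1 hy'] at hy2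
      exact ⟨⟨⟨⟨hx, hx'⟩, ⟨hy, hy'⟩⟩, hx2.trans hy2.symm⟩, hx2⟩
  · rintro ⟨x, y⟩ hx
    simp only [mem_coe, mem_filter, mem_product, hAm, hBm] at hx
    simp only [mem_coe, mem_parts]
    have hx1 := hx.1.1
    refine ⟨hx1.2.isPar_ct ha hx1.1, ?_⟩
    have := sz_ct_of_isCh hx1.1
    rw [skewSize_eq ha haa] at hva
    omega

end Tableaux

end

section

section Multitableaux

variable {n : ℕ} {a b : ℕ → ℕ}

theorem natCard_step_size {a' b' : ℕ → ℕ} (ha : IsPar n a) (ha' : IsPar n a') (haa : a' ≤ a)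
    (hb : IsPar n b) (hb' : IsPar n b') (hbb : b' ≤ b) (v : ℕ) :
    Nat.card {_P : Step a a' b b' // skewSize a a' = v ∧ skewSize b b' = v} =
      ∑ p ∈ parts n v, lrc n a' p a * lrc n b' p b := by
  by_cases h : skewSize a a' = v ∧ skewSize b b' = v
  · rw [← card_step ha ha' haa hb hb' hbb h.1 h.2]
    exact Nat.card_congr (Equiv.subtypeUnivEquiv fun _ => h)
  · rw [Finset.sum_eq_zero, Nat.card_eq_zero]
    · exact Or.inl ⟨fun P => h P.2⟩
    · intro p hp
      rw [mem_parts] at hp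
      by_contra hne
      have h1 := lrc_ne_zero ha (left_ne_zero_of_mul hne)
      have h2 := lrc_ne_zero hb (right_ne_zero_of_mul hne)
      rw [skewSize_eq ha haa, skewSize_eq hb hbb] at h
      omega

theorem LRMultiF.ext {r : ℕ} {M N : LRMultiF r a} (h : M.chain = N.chain) (hT : M.T = N.T) :
    M = N := by
  cases M
  cases N
  subst h hT
  rfl

/-- A multitableau together with a Littlewood–Richardson tableau extending it by one step. -/
def Ext (n r : ℕ) (a : ℕ → ℕ) : Type :=
  Σ a' : {a' // a' ∈ below n a}, LRMultiF r a'.1 × {T // IsLR a a'.1 T}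

theorem Ext.ext {r : ℕ} {x y : Ext n r a} (h : x.1.1 = y.1.1)
    (hc : x.2.1.chain = y.2.1.chain) (hT : x.2.1.T = y.2.1.T) (h2 : x.2.2.1 = y.2.2.1) :
    x = y := by
  obtain ⟨⟨a', ha⟩, M, T⟩ := x
  obtain ⟨⟨b', hb⟩, N, T'⟩ := y
  dsimp only at h
  subst h
  have h3 : M = N := LRMultiF.ext hc hT
  have h4 : T = T' := Subtype.ext h2
  rw [h3, h4]

theorem chain_last {r : ℕ} (M : LRMultiF r a) : M.chain (Fin.last r) = a :=
  funext M.last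

/-- Removing the last step of a multitableau. -/
def LRMultiF.toExt {r : ℕ} (ha : IsPar n a) (M : LRMultiF (r + 1) a) : Ext n r a :=
  ⟨⟨M.chain (Fin.last r).castSucc, by
      rw [mem_below ha]
      have h : M.chain (Fin.last r).castSucc ≤ a := by
        intro i
        rw [← M.last i]
        exact M.mono (Fin.last r) i
      exact ⟨⟨fun i j h => M.antitone _ i j h,
        fun i hi => Nat.le_zero.1 ((h i).trans (ha.2 i hi).le)⟩, h⟩⟩,
    { chain := fun k => M.chain k.castSucc
      antitone := fun k => M.antitone _
      zero := M.zero
      last := fun _ => rfl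
      mono := fun k i => M.mono k.castSucc i
      T := fun k => M.T k.castSucc
      lr := fun k => M.lr k.castSucc },
    ⟨M.T (Fin.last r), by
      have := M.lr (Fin.last r)
      rwa [Fin.succ_last, chain_last M] at this⟩⟩

/-- Extending a multitableau by one step. -/
def Ext.toMulti {r : ℕ} (ha : IsPar n a) (x : Ext n r a) : LRMultiF (r + 1) a where
  chain := Fin.snoc (α := fun _ => ℕ → ℕ) x.2.1.chain a
  antitone k := by
    refine Fin.lastCases ?_ (fun k => ?_) k
    · rw [Fin.snoc_last]
      exact fun i j h => ha.1 h
    · rw [Fin.snoc_castSucc]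
      exact x.2.1.antitone k
  zero i := by
    rw [← Fin.castSucc_zero, Fin.snoc_castSucc]
    exact x.2.1.zero i
  last i := by rw [Fin.snoc_last]
  mono k := by
    refine Fin.lastCases ?_ (fun k => ?_) k
    · rw [Fin.snoc_castSucc, Fin.succ_last, Fin.snoc_last, (chain_last x.2.1)]
      exact ((mem_below ha).1 x.1.2).2
    · rw [Fin.snoc_castSucc, Fin.succ_castSucc, Fin.snoc_castSucc]
      exact x.2.1.mono k
  T := Fin.snoc (α := fun _ => ℕ → ℕ → ℕ) x.2.1.T x.2.2.1
  lr k := by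
    refine Fin.lastCases ?_ (fun k => ?_) k
    · rw [Fin.snoc_castSucc, Fin.succ_last, Fin.snoc_last, Fin.snoc_last, (chain_last x.2.1)]
      exact x.2.2.2
    · rw [Fin.snoc_castSucc, Fin.succ_castSucc, Fin.snoc_castSucc, Fin.snoc_castSucc]
      exact x.2.1.lr k

/-- Multitableaux with `r + 1` steps are extensions of multitableaux with `r` steps. -/
def extEquiv (r : ℕ) (ha : IsPar n a) : LRMultiF (r + 1) a ≃ Ext n r a where
  toFun := LRMultiF.toExt ha
  invFun := Ext.toMulti ha
  left_inv M := by
    refine LRMultiF.ext ?_ ?_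
    · funext k
      refine Fin.lastCases ?_ (fun k => ?_) k
      · exact (Fin.snoc_last (α := fun _ => ℕ → ℕ) _ _).trans (chain_last M).symm
      · exact Fin.snoc_castSucc (α := fun _ => ℕ → ℕ) _ _ _
    · funext k
      refine Fin.lastCases ?_ (fun k => ?_) k
      · exact Fin.snoc_last (α := fun _ => ℕ → ℕ → ℕ) _ _
      · exact Fin.snoc_castSucc (α := fun _ => ℕ → ℕ → ℕ) _ _ _
  right_inv x := by
    refine Ext.ext ?_ ?_ ?_ ?_
    · exact (Fin.snoc_castSucc (α := fun _ => ℕ → ℕ) _ _ _).trans (chain_last x.2.1)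
    · funext k
      exact Fin.snoc_castSucc (α := fun _ => ℕ → ℕ) _ _ _
    · funext k
      exact Fin.snoc_castSucc (α := fun _ => ℕ → ℕ → ℕ) _ _ _
    · exact Fin.snoc_last (α := fun _ => ℕ → ℕ → ℕ) _ _

/-- The condition on pairs of extensions corresponding to `LRPairs`. -/
def ExtPair (n r : ℕ) (v : ℕ → ℕ) (x : Ext n r a × Ext n r b) : Prop :=
  ((∀ k, x.1.2.1.size k = v k) ∧ (∀ k, x.2.2.1.size k = v k) ∧
    ∀ k, x.1.2.1.cont k = x.2.2.1.cont k) ∧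
  skewContent a x.1.1.1 x.1.2.2.1 = skewContent b x.2.1.1 x.2.2.2.1 ∧
  skewSize a x.1.1.1 = v r ∧ skewSize b x.2.1.1 = v r

theorem extPair_iff (r : ℕ) (v : ℕ → ℕ) (ha : IsPar n a) (hb : IsPar n b)
    (M : LRMultiF (r + 1) a × LRMultiF (r + 1) b) :
    ((∀ k, M.1.size k = v k) ∧ (∀ k, M.2.size k = v k) ∧ ∀ k, M.1.cont k = M.2.cont k) ↔
      ExtPair n r v (((extEquiv r ha).prodCongr (extEquiv r hb)) M) := by
  have h1 : M.1.chain (Fin.last r).succ = a := by rw [Fin.succ_last, (chain_last M.1)]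
  have h2 : M.2.chain (Fin.last r).succ = b := by rw [Fin.succ_last, (chain_last M.2)]
  have e1 : M.1.size (Fin.last r) = skewSize a (M.1.chain (Fin.last r).castSucc) := by
    rw [LRMultiF.size, h1]
  have e2 : M.2.size (Fin.last r) = skewSize b (M.2.chain (Fin.last r).castSucc) := by
    rw [LRMultiF.size, h2]
  have e3 : M.1.cont (Fin.last r) =
      skewContent a (M.1.chain (Fin.last r).castSucc) (M.1.T (Fin.last r)) := by
    rw [LRMultiF.cont, h1]
  have e4 : M.2.cont (Fin.last r) =
      skewContent b (M.2.chain (Fin.last r).castSucc) (M.2.T (Fin.last r)) := by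
    rw [LRMultiF.cont, h2]
  constructor
  · rintro ⟨k1, k2, k3⟩
    exact ⟨⟨fun k => k1 k.castSucc, fun k => k2 k.castSucc, fun k => k3 k.castSucc⟩,
      e3.symm.trans ((k3 _).trans e4), e1.symm.trans (k1 _), e2.symm.trans (k2 _)⟩
  · rintro ⟨⟨k1, k2, k3⟩, k4, k5, k6⟩
    refine ⟨fun k => ?_, fun k => ?_, fun k => ?_⟩
    · exact Fin.lastCases (motive := fun k => M.1.size k = v k) (e1.trans k5) k1 k
    · exact Fin.lastCases (motive := fun k => M.2.size k = v k) (e2.trans k6) k2 k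
    · exact Fin.lastCases (motive := fun k => M.1.cont k = M.2.cont k)
        (e3.trans (k4.trans e4.symm)) k3 k

/-- Removing the last step from a pair of multitableaux. -/
def lrPairsEquiv (r : ℕ) (v : ℕ → ℕ) (ha : IsPar n a) (hb : IsPar n b) :
    LRPairs (r + 1) a b (fun k => v k) ≃
      Σ x : {b' // b' ∈ below n b} × {a' // a' ∈ below n a},
        LRPairs r x.2.1 x.1.1 (fun k => v k) ×
          {_P : Step a x.2.1 b x.1.1 // skewSize a x.2.1 = v r ∧ skewSize b x.1.1 = v r} :=
  (((extEquiv r ha).prodCongr (extEquiv r hb)).subtypeEquiv (extPair_iff r v ha hb)).trans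
    { toFun := fun x => ⟨(x.1.2.1, x.1.1.1),
        (⟨(x.1.1.2.1, x.1.2.2.1), x.2.1⟩, ⟨⟨(x.1.1.2.2, x.1.2.2.2), x.2.2.1⟩, x.2.2.2⟩)⟩
      invFun := fun y => ⟨(⟨y.1.2, (y.2.1.1.1, y.2.2.1.1.1)⟩, ⟨y.1.1, (y.2.1.1.2, y.2.2.1.1.2)⟩),
        ⟨y.2.1.2, y.2.2.1.2, y.2.2.2⟩⟩
      left_inv := fun _ => rfl
      right_inv := fun _ => rfl }

theorem lrPairs_card (v : ℕ → ℕ) (r : ℕ) : ∀ {a b : ℕ → ℕ}, IsPar n a → IsPar n b →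
    Finite (LRPairs r a b (fun k => v k)) ∧
      Nat.card (LRPairs r a b (fun k => v k)) = lrn n v r a b := by
  induction r with
  | zero =>
    intro a b ha hb
    have hsub : Subsingleton (LRPairs 0 a b (fun k => v k)) := by
      refine ⟨fun x y => ?_⟩
      refine Subtype.ext (Prod.ext (LRMultiF.ext ?_ ?_) (LRMultiF.ext ?_ ?_))
      · funext k
        exact (congrArg _ (Subsingleton.elim (α := Fin 1) k _)).trans ((chain_last x.1.1).trans
          ((chain_last y.1.1).symm.trans (congrArg _ (Subsingleton.elim (α := Fin 1) _ k))))
      · exact Subsingleton.elim _ _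
      · funext k
        exact (congrArg _ (Subsingleton.elim (α := Fin 1) k _)).trans ((chain_last x.1.2).trans
          ((chain_last y.1.2).symm.trans (congrArg _ (Subsingleton.elim (α := Fin 1) _ k))))
      · exact Subsingleton.elim _ _
    refine ⟨inferInstance, ?_⟩
    rw [lrn]
    split_ifs with h
    · obtain ⟨rfl, rfl⟩ := h
      have M : LRMultiF 0 (0 : ℕ → ℕ) :=
        { chain := fun _ _ => 0
          antitone := fun _ _ _ _ => le_rfl
          zero := fun _ => rfl
          last := fun _ => rfl
          mono := fun k => k.elim0
          T := fun k => k.elim0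
          lr := fun k => k.elim0 }
      have : Nonempty (LRPairs 0 (0 : ℕ → ℕ) 0 (fun k => v k)) :=
        ⟨⟨(M, M), fun k => k.elim0, fun k => k.elim0, fun k => k.elim0⟩⟩
      exact Nat.card_unique
    · rw [Nat.card_eq_zero]
      refine Or.inl ⟨fun x => h ⟨?_, ?_⟩⟩
      · exact (chain_last x.1.1).symm.trans (funext x.1.1.zero)
      · exact (chain_last x.1.2).symm.trans (funext x.1.2.zero)
  | succ r ih =>
    intro a b ha hb
    have hpa : ∀ x : {a' // a' ∈ below n a}, IsPar n x.1 ∧ x.1 ≤ a := fun x => (mem_below ha).1 x.2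
    have hpb : ∀ x : {b' // b' ∈ below n b}, IsPar n x.1 ∧ x.1 ≤ b := fun x => (mem_below hb).1 x.2
    have hf1 : ∀ x : {b' // b' ∈ below n b} × {a' // a' ∈ below n a},
        Finite (LRPairs r x.2.1 x.1.1 (fun k => v k)) := fun x =>
      (ih (hpa x.2).1 (hpb x.1).1).1
    have hf2 : ∀ x : {b' // b' ∈ below n b} × {a' // a' ∈ below n a},
        Finite (Step a x.2.1 b x.1.1) := fun x =>
      finite_step ha (hpa x.2).1 (hpa x.2).2 hb (hpb x.1).1 (hpb x.1).2
    refine ⟨Finite.of_equiv _ (lrPairsEquiv r v ha hb).symm, ?_⟩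
    rw [Nat.card_congr (lrPairsEquiv r v ha hb), Nat.card_sigma, lrn, Fintype.sum_prod_type,
      ← Finset.sum_coe_sort (below n b)]
    refine Finset.sum_congr rfl (fun y _ => ?_)
    rw [← Finset.sum_coe_sort (below n a)]
    refine Finset.sum_congr rfl (fun x _ => ?_)
    rw [Nat.card_prod, (ih (hpa x).1 (hpb y).1).2,
      natCard_step_size ha (hpa x).1 (hpa x).2 hb (hpb y).1 (hpb y).2]

end Multitableaux

end

section

section Burnside

variable {n : ℕ} {K : Type}

/-- The number of points of each color. -/
def cnt (F : Fin n → K) (k : K) : ℕ := Nat.card {x : Fin n // F x = k}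

theorem cnt_eq (F : Fin n → K) (k : K) : cnt F k = #{x | F x = k} := by
  rw [cnt, Nat.card_eq_fintype_card, Fintype.card_subtype]

theorem cnt_comp_perm (F : Fin n → K) (g : Perm (Fin n)) : cnt (F ∘ g) = cnt F := by
  ext k
  exact Nat.card_congr (g.subtypeEquiv fun _ => Iff.rfl)

theorem exists_comp_eq {F G : Fin n → K} (h : cnt F = cnt G) : ∃ g : Perm (Fin n), F ∘ g = G := by
  let e : ∀ k, {x // G x = k} ≃ {x // F x = k} := fun k =>
    Classical.choice (Finite.card_eq.1 (congrFun h.symm k))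
  exact ⟨Equiv.ofFiberEquiv e, funext fun x => Equiv.ofFiberEquiv_map e x⟩

variable [Fintype K]

theorem sum_cnt (F : Fin n → K) : ∑ k, cnt F k = n := by
  simp only [cnt_eq]
  have h := Finset.card_eq_sum_card_fiberwise (f := F) (s := univ) (t := univ)
    (fun _ _ => by simp)
  rwa [Finset.card_univ, Fintype.card_fin, eq_comm] at h

/-- The marginal of `A` along `f`. -/
def marg {J : Type} (f : K → J) (A : K → ℕ) (j : J) : ℕ := ∑ k with f k = j, A k

theorem cnt_comp {J : Type} (F : Fin n → K) (f : K → J) (j : J) :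
    cnt (fun x => f (F x)) j = marg f (cnt F) j := by
  simp only [cnt_eq, marg]
  rw [Finset.card_eq_sum_card_fiberwise (f := F) (t := {k | f k = j})]
  · refine Finset.sum_congr rfl (fun k hk => ?_)
    rw [Finset.filter_filter]
    congr 1
    refine Finset.filter_congr (fun x _ => ?_)
    rw [mem_filter] at hk
    constructor
    · exact fun h => h.2
    · rintro rfl
      exact ⟨hk.2, rfl⟩
  · intro x hx
    simpa using hx

theorem exists_cnt_eq {A : K → ℕ} (hA : ∑ k, A k = n) : ∃ F : Fin n → K, cnt F = A := by
  have hc : Fintype.card (Fin n) = Fintype.card (Σ k, Fin (A k)) := by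
    simp [Fintype.card_sigma, hA]
  let e := Fintype.equivOfCardEq hc
  refine ⟨fun x => (e x).1, funext fun k => ?_⟩
  rw [cnt, Nat.card_congr ((e.subtypeEquiv fun _ => Iff.rfl).trans (Equiv.sigmaSubtype k)),
    Nat.card_eq_fintype_card, Fintype.card_fin]

theorem sum_card_stab {A : K → ℕ} (hA : ∑ k, A k = n) :
    ∑ F : Fin n → K with cnt F = A, #{g : Perm (Fin n) | F ∘ g = F} = n.factorial := by
  obtain ⟨F₀, rfl⟩ := exists_cnt_eq hA
  have h1 : n.factorial = #(univ : Finset (Perm (Fin n))) := by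
    rw [Finset.card_univ, Fintype.card_perm, Fintype.card_fin]
  rw [h1, Finset.card_eq_sum_card_fiberwise (f := fun g : Perm (Fin n) => F₀ ∘ g)
    (t := {F | cnt F = cnt F₀})]
  · refine Finset.sum_congr rfl (fun F hF => ?_)
    rw [mem_filter] at hF
    obtain ⟨h, rfl⟩ := exists_comp_eq hF.2.symm
    refine Finset.card_bij' (fun g _ => h * g) (fun g _ => h⁻¹ * g) ?_ ?_ (by simp) (by simp)
    · intro g hg
      simpa [Function.comp_assoc] using hg
    · intro g hg
      rw [mem_filter] at hg ⊢
      refine ⟨mem_univ _, ?_⟩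
      rw [Function.comp_assoc, ← Perm.coe_mul, mul_inv_cancel_left]
      exact hg.2
  · intro g _
    simpa using cnt_comp_perm F₀ g

/-- Burnside's lemma for colorings whose color counts satisfy a given condition. -/
theorem sum_card_fixed (Q : (K → ℕ) → Prop) :
    ∑ g : Perm (Fin n), Nat.card {F : Fin n → K // F ∘ g = F ∧ Q (cnt F)} =
      n.factorial * Nat.card {A : K → ℕ // ∑ k, A k = n ∧ Q A} := by
  set S : Finset (K → ℕ) := (univ.image fun F : Fin n → K => cnt F).filter Q with hS
  have hmem : ∀ A, A ∈ S ↔ ∑ k, A k = n ∧ Q A := by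
    intro A
    rw [hS, mem_filter, mem_image]
    constructor
    · rintro ⟨⟨F, _, rfl⟩, h⟩
      exact ⟨sum_cnt F, h⟩
    · rintro ⟨h1, h2⟩
      obtain ⟨F, hF⟩ := exists_cnt_eq h1
      exact ⟨⟨F, mem_univ _, hF⟩, h2⟩
  have h1 : Nat.card {A : K → ℕ // ∑ k, A k = n ∧ Q A} = #S := by
    rw [← Nat.card_eq_finsetCard]
    exact Nat.card_congr (Equiv.subtypeEquivRight fun A => (hmem A).symm)
  have h2 : ∀ g : Perm (Fin n), Nat.card {F : Fin n → K // F ∘ g = F ∧ Q (cnt F)} =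
      ∑ F : Fin n → K with Q (cnt F), if F ∘ g = F then 1 else 0 := by
    intro g
    rw [← Finset.card_filter, Finset.filter_filter, Nat.card_eq_fintype_card, Fintype.card_subtype]
    simp only [and_comm]
  simp only [h2]
  rw [Finset.sum_comm, ← Finset.sum_fiberwise_of_maps_to (t := S) (g := fun F => cnt F), h1,
    mul_comm, ← smul_eq_mul, ← Finset.sum_const]
  · refine Finset.sum_congr rfl (fun A hA => ?_)
    rw [← sum_card_stab ((hmem A).1 hA).1, Finset.filter_filter]
    refine Finset.sum_congr ?_ (fun F _ => (Finset.card_filter _ _).symm)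
    refine Finset.filter_congr (fun F _ => ?_)
    constructor
    · exact fun h => h.2
    · rintro rfl
      exact ⟨((hmem _).1 hA).2, rfl⟩
  · intro F hF
    rw [mem_filter] at hF
    exact (hmem _).2 ⟨sum_cnt F, hF.2⟩

theorem permChar_eq_card (a : Fin n → ℕ) (g : Perm (Fin n)) :
    permChar n (extc a) g =
      (Nat.card {F : Fin n → Fin n // F ∘ g = F ∧ ∀ i, cnt F i = a i} : ℚ) := by
  rw [permChar]
  congr 1
  refine Nat.card_congr ⟨fun f => ⟨fun x => ⟨f.1 x, ?_⟩, ?_, fun i => ?_⟩,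
    fun F => ⟨fun x => F.1 x, fun k => ?_, fun x => ?_⟩, fun _ => rfl, fun _ => rfl⟩
  · by_contra hx
    have h1 := f.2.1 (f.1 x)
    rw [extc, dif_neg hx, Nat.card_eq_zero] at h1
    rcases h1 with h1 | h1
    · exact h1.elim ⟨x, rfl⟩
    · exact h1.not_finite inferInstance
  · ext x
    exact f.2.2 x
  · have h1 := f.2.1 i
    rw [extc, dif_pos i.2] at h1
    rw [← h1, cnt]
    simp only [Fin.ext_iff]
  · rw [extc]
    split_ifs with hk
    · rw [← F.2.2, cnt]
      simp only [Fin.ext_iff]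
    · rw [Nat.card_eq_zero]
      exact Or.inl ⟨fun x => hk (x.2 ▸ (F.1 x.1).2)⟩
  · exact congrArg Fin.val (congrFun F.2.1 x)

theorem marg_fst {J : Type} [Fintype J] (A : Fin n × J → ℕ) (i : Fin n) :
    marg (fun q => q.1) A i = ∑ k, A (i, k) := by
  rw [marg]
  exact Finset.sum_bij' (fun q _ => q.2) (fun k _ => (i, k)) (by simp) (by simp)
    (by rintro ⟨_, _⟩ h; simp_all) (by simp) (by rintro ⟨_, _⟩ h; simp_all)

theorem marg_snd {I J : Type} [Fintype I] [Fintype J] (f : J → Fin n) (A : I × J → ℕ) (i : Fin n) :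
    marg (fun q => f q.2) A i = ∑ k, marg f (fun j => A (k, j)) i := by
  simp only [marg]
  rw [← Finset.sum_product']
  exact Finset.sum_congr (by ext; simp) (fun _ _ => rfl)

theorem marg_id (A : Fin n → ℕ) (i : Fin n) : marg (fun q => q) A i = A i := by
  refine (Finset.sum_congr ?_ fun _ _ => rfl).trans (Finset.sum_singleton A i)
  ext
  simp

theorem sum_permChar_mul (a c : Fin n → ℕ) (ha : ∑ i, a i = n) :
    ∑ g : Perm (Fin n), permChar n (extc a) g * permChar n (extc c) g =
      (n.factorial : ℚ) * cf a (∏ k, hh n ℚ (c k)) := by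
  have h1 : ∀ g : Perm (Fin n), permChar n (extc a) g * permChar n (extc c) g =
      (Nat.card {F : Fin n → Fin n × Fin n // F ∘ g = F ∧
        ((∀ i, marg (fun q => q.1) (cnt F) i = a i) ∧
          ∀ k, marg (fun q => q.2) (cnt F) k = c k)} : ℚ) := by
    intro g
    rw [permChar_eq_card, permChar_eq_card, ← Nat.cast_mul, ← Nat.card_prod]
    congr 1
    simp only [← cnt_comp]
    exact Nat.card_congr
      ⟨fun P => ⟨fun x => (P.1.1 x, P.2.1 x),
        funext fun x => Prod.ext (congrFun P.1.2.1 x) (congrFun P.2.2.1 x), P.1.2.2, P.2.2.2⟩,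
      fun F => (⟨fun x => (F.1 x).1, funext fun x => congrArg Prod.fst (congrFun F.2.1 x),
          F.2.2.1⟩,
        ⟨fun x => (F.1 x).2, funext fun x => congrArg Prod.snd (congrFun F.2.1 x), F.2.2.2⟩),
      fun _ => rfl, fun _ => rfl⟩
  simp only [h1]
  rw [← Nat.cast_sum, sum_card_fixed fun A : Fin n × Fin n → ℕ =>
    (∀ i, marg (fun q => q.1) A i = a i) ∧ ∀ k, marg (fun q => q.2) A k = c k, cf_prod_hh_eq_card,
    Nat.cast_mul]
  congr 2
  refine Nat.card_congr (Equiv.subtypeEquivRight fun A => ?_)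
  simp only [marg_fst, marg_snd (fun q => q), marg_id, Fintype.sum_prod_type]
  refine and_iff_right_of_imp fun h => ?_
  exact (Finset.sum_congr rfl fun i _ => h.1 i).trans ha

theorem sum_permChar_mul_mul (a b c : Fin n → ℕ) (ha : ∑ i, a i = n) :
    ∑ g : Perm (Fin n), permChar n (extc a) g * permChar n (extc b) g * permChar n (extc c) g =
      (n.factorial : ℚ) * cf a (cf b (∏ k, HH n (c k))) := by
  have h1 : ∀ g : Perm (Fin n),
      permChar n (extc a) g * permChar n (extc b) g * permChar n (extc c) g =
      (Nat.card {F : Fin n → Fin n × Fin n × Fin n // F ∘ g = F ∧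
        ((∀ i, marg (fun q => q.1) (cnt F) i = a i) ∧
          (∀ j, marg (fun q => q.2.1) (cnt F) j = b j) ∧
          ∀ k, marg (fun q => q.2.2) (cnt F) k = c k)} : ℚ) := by
    intro g
    rw [permChar_eq_card, permChar_eq_card, permChar_eq_card, mul_assoc, ← Nat.cast_mul,
      ← Nat.cast_mul, ← Nat.card_prod, ← Nat.card_prod]
    congr 1
    simp only [← cnt_comp]
    exact Nat.card_congr
      ⟨fun P => ⟨fun x => (P.1.1 x, P.2.1.1 x, P.2.2.1 x),
        funext fun x => Prod.ext (congrFun P.1.2.1 x)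
          (Prod.ext (congrFun P.2.1.2.1 x) (congrFun P.2.2.2.1 x)),
        P.1.2.2, P.2.1.2.2, P.2.2.2.2⟩,
      fun F => (⟨fun x => (F.1 x).1, funext fun x => congrArg (fun q => q.1) (congrFun F.2.1 x),
          F.2.2.1⟩,
        ⟨fun x => (F.1 x).2.1, funext fun x => congrArg (fun q => q.2.1) (congrFun F.2.1 x),
          F.2.2.2.1⟩,
        ⟨fun x => (F.1 x).2.2, funext fun x => congrArg (fun q => q.2.2) (congrFun F.2.1 x),
          F.2.2.2.2⟩),
      fun _ => rfl, fun _ => rfl⟩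
  simp only [h1]
  rw [← Nat.cast_sum, sum_card_fixed fun A : Fin n × Fin n × Fin n → ℕ =>
    (∀ i, marg (fun q => q.1) A i = a i) ∧ (∀ j, marg (fun q => q.2.1) A j = b j) ∧
      ∀ k, marg (fun q => q.2.2) A k = c k, cf_cf_prod_HH_eq_card, Nat.cast_mul]
  congr 2
  refine Nat.card_congr (Equiv.subtypeEquivRight fun A => ?_)
  simp only [marg_fst, marg_snd (fun q : Fin n × Fin n => q.1),
    marg_snd (fun q : Fin n × Fin n => q.2),
    marg_snd (fun q => q), marg_id, Fintype.sum_prod_type]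
  refine and_iff_right_of_imp fun h => ?_
  exact (Finset.sum_congr rfl fun i _ => h.1 i).trans ha

end Burnside

end

section

open MvPolynomial

section Irr

variable {n : ℕ}

theorem irrChar_eq (a : ℕ → ℕ) (g : Perm (Fin n)) :
    irrChar n a g = ∑ σ : Perm (Fin n), ((Perm.sign σ : ℤ) : ℚ) *
      if up n (fun _ => 0) ∘ σ ≤ up n a then
        permChar n (extc (up n a - up n (fun _ => 0) ∘ σ)) g else 0 := by
  rw [irrChar]
  refine Finset.sum_congr rfl (fun σ _ => ?_)
  congr 1
  have h0 : ∀ i : Fin n, (a i : ℤ) - i + (σ i : ℕ) =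
      (up n a i : ℤ) - (up n (fun _ => 0) (σ i) : ℕ) := by
    intro i
    have h1 := i.2
    have h2 := (σ i).2
    simp only [up]
    omega
  have h1 : (∀ k, 0 ≤ (if h : k < n then (a k : ℤ) - k + ((σ ⟨k, h⟩ : Fin n) : ℕ) else 0)) ↔
      up n (fun _ => 0) ∘ σ ≤ up n a := by
    constructor
    · intro h i
      have := h i
      rw [dif_pos i.2, Fin.eta, h0] at this
      exact Int.ofNat_le.1 (sub_nonneg.1 this)
    · intro h k
      split_ifs with hk
      · exact (h0 ⟨k, hk⟩).symm ▸ sub_nonneg.2 (Int.ofNat_le.2 (h ⟨k, hk⟩))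
      · exact le_rfl
  rw [permCharZ]
  simp only [h1]
  congr 2
  ext k
  rw [extc]
  split_ifs with hk
  · have h2 := h0 ⟨k, hk⟩
    dsimp only at h2
    rw [h2, Pi.sub_apply, Function.comp_apply]
    omega
  · rfl

theorem sum_up_sub {a : ℕ → ℕ} {σ : Perm (Fin n)} (h : up n (fun _ => 0) ∘ σ ≤ up n a) :
    ∑ i, (up n a - up n (fun _ => 0) ∘ σ) i = sz n a := by
  have h1 : ∑ i, (up n a - up n (fun _ => 0) ∘ σ) i + ∑ i, (up n (fun _ => 0) ∘ σ) i =
      ∑ i, up n a i := by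
    rw [← Finset.sum_add_distrib]
    exact Finset.sum_congr rfl (fun i _ => Nat.sub_add_cancel (h i))
  have h2 : ∑ i, (up n (fun _ => 0) ∘ σ) i = ∑ i, up n (fun _ => 0) i :=
    Equiv.sum_comp σ (up n fun _ => 0)
  rw [h2, sum_up, sum_up] at h1
  simp only [sz, Finset.sum_const_zero, zero_add] at h1 ⊢
  exact Nat.add_right_cancel h1

/-- Passing from permutation characters to irreducible characters. -/
theorem sum_irrChar_mul {S : Type*} [CommRing S] (φ : S →+ ℚ) (F : Perm (Fin n) → ℚ)
    (P : MvPolynomial (Fin n) S)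
    (h : ∀ d : Fin n → ℕ, ∑ i, d i = n →
      ∑ g, permChar n (extc d) g * F g = n.factorial * φ (cf d P))
    {a : ℕ → ℕ} (ha : sz n a = n) :
    ∑ g, irrChar n a g * F g =
      n.factorial * φ (cf (up n a) (alt S (up n fun _ => 0) * P)) := by
  simp only [irrChar_eq, Finset.sum_mul]
  rw [Finset.sum_comm, cf_alt_mul, map_sum, Finset.mul_sum]
  refine Finset.sum_congr rfl (fun σ _ => ?_)
  rw [← zsmul_eq_mul, map_zsmul, zsmul_eq_mul, mul_left_comm]
  simp only [mul_assoc]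
  rw [← Finset.mul_sum]
  congr 1
  split_ifs with hσ
  · exact h _ ((sum_up_sub hσ).trans ha)
  · simp

theorem extc_of_isPar {v : ℕ → ℕ} (hv : IsPar n v) : extc (fun k : Fin n => v k) = v := by
  ext i
  rw [extc]
  split_ifs with h
  · rfl
  · exact (hv.2 i (by omega)).symm

theorem sum_irrChar_mul_permChar {a : ℕ → ℕ} (ha : sz n a = n) (c : Fin n → ℕ) :
    ∑ g, irrChar n a g * permChar n (extc c) g =
      n.factorial * cf (up n a) (alt ℚ (up n fun _ => 0) * ∏ k, hh n ℚ (c k)) :=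
  sum_irrChar_mul (AddMonoidHom.id ℚ) _ _ (fun d hd => sum_permChar_mul d c hd) ha

theorem sum_permChar_mul_irrChar {a : ℕ → ℕ} (ha : sz n a = n) (d : Fin n → ℕ) :
    ∑ g, permChar n (extc d) g * irrChar n a g =
      n.factorial * cf d (skewS n ℚ a fun _ => 0) := by
  rw [cf_skewS, ← sum_irrChar_mul_permChar ha]
  · exact Finset.sum_congr rfl (fun g _ => mul_comm _ _)

theorem sum_irrChar_mul_irrChar {a b : ℕ → ℕ} (ha : a ∈ parts n n) (hb : b ∈ parts n n) :
    ∑ g, irrChar n a g * irrChar n b g = if a = b then (n.factorial : ℚ) else 0 := by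
  rw [mem_parts] at ha hb
  rw [sum_irrChar_mul (AddMonoidHom.id ℚ) _ (skewS n ℚ b fun _ => 0)
    (fun d _ => sum_permChar_mul_irrChar hb.2 d) ha.2, alt_mul_S hb.1, cf_alt_up ha.1 hb.1]
  simp [eq_comm]

theorem sum_irrChar_mul_irrChar_mul_permChar {a b v : ℕ → ℕ} (ha : a ∈ parts n n)
    (hb : b ∈ parts n n) (hv : IsPar n v) :
    ∑ g, irrChar n a g * (irrChar n b g * permChar n v g) = n.factorial * (lrn n v n a b : ℚ) := by
  rw [mem_parts] at ha hb
  have h1 : ∀ d : Fin n → ℕ, ∑ i, d i = n →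
      ∑ g, permChar n (extc d) g * (irrChar n b g * permChar n v g) =
        n.factorial * cf d (cf (up n b) (alt (Px n) (up n fun _ => 0) *
          ∏ k : Fin n, HH n (v k))) := by
    intro d hd
    have := sum_irrChar_mul (AddMonoidHom.mk' (cf d) (cf_add d))
      (fun g => permChar n (extc d) g * permChar n v g) (∏ k : Fin n, HH n (v k)) ?_ hb.2
    · rw [AddMonoidHom.mk'_apply] at this
      rw [← this]
      exact Finset.sum_congr rfl (fun g _ => mul_left_comm _ _ _)
    · intro e he
      rw [AddMonoidHom.mk'_apply, ← sum_permChar_mul_mul d e (fun k => v k) hd, extc_of_isPar hv]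
      exact Finset.sum_congr rfl (fun g _ => by ring)
  have := sum_irrChar_mul (AddMonoidHom.id ℚ) _ _ h1 ha.2
  rw [this, ← cf_cf_prod_HH v n ha.1 hb.1, cf_C_mul, Finset.prod_range]
  rfl

/-- The number of chains of horizontal strips with shape `l` and content `v`. -/
def kst (n : ℕ) (v l : ℕ → ℕ) : ℕ := #{L ∈ chains n n (fun _ => 0) l | HasCt n n v L}

theorem cf_alt_mul_prod_hh_eq_kst {l : ℕ → ℕ} (v : ℕ → ℕ) (hl : IsPar n l) :
    cf (up n l) (alt ℚ (up n fun _ => 0) * ∏ k : Fin n, hh n ℚ (v k)) = (kst n v l : ℚ) := by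
  rw [kst, ← cf_alt_mul_prod_hh (R := ℚ) IsPar_zero hl, Finset.prod_range]

theorem prod_hh_eq_sum {v : ℕ → ℕ} (hv : sz n v = n) :
    ∏ k : Fin n, hh n ℚ (v k) =
      ∑ p ∈ parts n n, C (kst n v p : ℚ) * skewS n ℚ p (fun _ => 0) := by
  apply mul_left_cancel₀ (alt_zero_ne_zero (R := ℚ) (n := n))
  have hAS := (AS_alt (R := ℚ) (up n (fun _ => 0))).mul_Sy
    (Sy.prod univ (fun k : Fin n => hh n ℚ (v k)) fun k _ => Sy_hh _)
  rw [hAS.expand (parts n n) (fun l hl => (mem_parts.1 hl).1), Finset.mul_sum]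
  · refine Finset.sum_congr rfl (fun p hp => ?_)
    have := (mem_parts.1 hp).1
    rw [cf_alt_mul_prod_hh_eq_kst v this, ← alt_mul_S this]
    ring
  · intro p hp hpN
    rw [cf_alt_mul_prod_hh_eq_kst v hp, Nat.cast_eq_zero]
    by_contra hne
    rw [kst, ← ne_eq, Finset.card_ne_zero] at hne
    obtain ⟨L, hL⟩ := hne
    rw [mem_filter, mem_chains hp] at hL
    have := hL.2.sz_eq hL.1
    refine hpN (mem_parts.2 ⟨hp, ?_⟩)
    rw [this, hv]
    simp [sz]

/-- Young's rule. -/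
theorem permChar_eq_sum {v : ℕ → ℕ} (hv : v ∈ parts n n) (g : Perm (Fin n)) :
    permChar n v g = ∑ p ∈ parts n n, (kst n v p : ℚ) * irrChar n p g := by
  rw [mem_parts] at hv
  set ψ : Perm (Fin n) → ℚ := fun g =>
    permChar n v g - ∑ p ∈ parts n n, (kst n v p : ℚ) * irrChar n p g with hψ
  have h1 : ∀ d : Fin n → ℕ, ∑ i, d i = n →
      ∑ g, permChar n (extc d) g * ψ g = n.factorial * AddMonoidHom.id ℚ
        (cf d (0 : MvPolynomial (Fin n) ℚ)) := by
    intro d hd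
    have h2 := sum_permChar_mul d (fun k => v k) hd
    rw [extc_of_isPar hv.1, prod_hh_eq_sum hv.2, cf_sum, Finset.mul_sum] at h2
    simp only [hψ, mul_sub, Finset.sum_sub_distrib, h2, Finset.mul_sum, cf_zero, map_zero, mul_zero]
    rw [Finset.sum_comm, sub_eq_zero]
    refine Finset.sum_congr rfl (fun p hp => ?_)
    rw [cf_C_mul, mul_left_comm, ← sum_permChar_mul_irrChar (mem_parts.1 hp).2, Finset.mul_sum]
    exact Finset.sum_congr rfl (fun g _ => mul_left_comm _ _ _)
  have h2 : ∀ p ∈ parts n n, ∑ g, irrChar n p g * ψ g = 0 := by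
    intro p hp
    rw [sum_irrChar_mul _ _ _ h1 (mem_parts.1 hp).2]
    simp
  have h3 : ∑ g, ψ g * ψ g = 0 := by
    have h4 := h1 (fun k => v k) (by rw [← Finset.sum_range]; exact hv.2)
    rw [extc_of_isPar hv.1, cf_zero, map_zero, mul_zero] at h4
    have h5 : ∀ g, ψ g * ψ g = permChar n v g * ψ g -
        ∑ p ∈ parts n n, (kst n v p : ℚ) * (irrChar n p g * ψ g) := by
      intro g
      conv_lhs => rw [hψ]
      simp only [sub_mul, Finset.sum_mul, mul_assoc]
      rfl
    simp only [h5, Finset.sum_sub_distrib, h4]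
    rw [Finset.sum_comm, zero_sub, neg_eq_zero]
    refine Finset.sum_eq_zero (fun p hp => ?_)
    rw [← Finset.mul_sum, h2 p hp, mul_zero]
  rw [Finset.sum_mul_self_eq_zero_iff] at h3
  exact sub_eq_zero.1 (h3 g (mem_univ _))

theorem lrn_eq_sum {a b v : ℕ → ℕ} (ha : a ∈ parts n n) (hb : b ∈ parts n n)
    (hv : v ∈ parts n n) :
    (lrn n v n a b : ℚ) = ∑ p ∈ parts n n, (kst n v p : ℚ) * kron n a b p := by
  have hn : (n.factorial : ℚ) ≠ 0 := Nat.cast_ne_zero.2 n.factorial_ne_zero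
  have h1 := sum_irrChar_mul_irrChar_mul_permChar ha hb (mem_parts.1 hv).1
  apply mul_left_cancel₀ hn
  rw [← h1, Finset.mul_sum]
  simp only [permChar_eq_sum hv, Finset.mul_sum]
  rw [Finset.sum_comm]
  refine Finset.sum_congr rfl (fun p _ => ?_)
  rw [kron, innerChar, mul_left_comm, mul_div_cancel₀ _ hn, Finset.mul_sum]
  exact Finset.sum_congr rfl (fun g _ => by ring)

end Irr

end

section

section Kostka

variable {n : ℕ}

theorem IsCh.sz_eq_prefix {l v : ℕ → ℕ} {L : ℕ → ℕ → ℕ} (hl : IsPar n l)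
    (h : IsCh n (fun _ => 0) l L) (hc : HasCt n n v L) {k : ℕ} (hk : k ≤ n) :
    sz k (L k) = sz k v := by
  have h1 : sz n (L k) = sz k (L k) := by
    have : IsPar k (L k) := ⟨(h.isPar hl k).1, h.eq_zero k⟩
    exact this.sz_eq hk
  rw [← h1]
  clear h1
  induction k with
  | zero => rw [h.bot]; simp [sz]
  | succ k ih => rw [hc k (by omega), ih (by omega), sz_succ]

theorem dominates_of_kst_ne_zero {l v : ℕ → ℕ} (hl : IsPar n l) (hv : IsPar n v)
    (h : kst n v l ≠ 0) : Dominates l v := by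
  rw [kst, Finset.card_ne_zero] at h
  obtain ⟨L, hL⟩ := h
  rw [mem_filter, mem_chains hl] at hL
  have h1 : ∀ k ≤ n, sz k v ≤ sz k l := by
    intro k hk
    rw [← hL.1.sz_eq_prefix hl hL.2 hk]
    exact sz_mono (hL.1.le k) k
  intro k
  rcases le_total k n with hk | hk
  · exact h1 k hk
  · have := h1 n le_rfl
    rwa [← hl.sz_eq hk, ← hv.sz_eq hk] at this

theorem kst_self {v : ℕ → ℕ} (hv : IsPar n v) : kst n v v = 1 := by
  rw [kst, Finset.card_eq_one]
  refine ⟨canon v, ?_⟩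
  ext L
  rw [mem_filter, mem_chains hv, Finset.mem_singleton]
  constructor
  · rintro ⟨h, hc⟩
    ext k i
    rw [canon]
    split_ifs with hi
    · rcases le_total k n with hk | hk
      · have h1 := h.sz_eq_prefix hv hc hk
        rw [sz, sz, Finset.sum_eq_sum_iff_of_le (fun j _ => h.le k j)] at h1
        exact h1 i (Finset.mem_range.2 hi)
      · rw [h.top k hk]
    · exact h.eq_zero k i (by omega)
  · rintro rfl
    exact ⟨isCh_canon hv, hasCt_canon⟩

/-- The shape left after removing a horizontal strip of size `m` from the columns with the
longest possible bottoms. -/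
def strip (m : ℕ) (l : ℕ → ℕ) (i : ℕ) : ℕ := l i - m + min m (l (i + 1))

theorem hs_strip (m : ℕ) {l : ℕ → ℕ} (hl : Antitone l) : Hs (strip m l) l := by
  intro i
  have := hl (Nat.le_succ i)
  rw [strip]
  simp only [Nat.succ_eq_add_one] at this
  omega

theorem sz_strip {m : ℕ} {l : ℕ → ℕ} (hm : m ≤ l 0) (k : ℕ) :
    sz k (strip m l) + m = sz k l + min m (l k) := by
  induction k with
  | zero => simp [sz, hm]
  | succ k ih =>
    rw [sz_succ, sz_succ, strip]
    omega

theorem exists_isCh {v : ℕ → ℕ} (hv : Antitone v) (r : ℕ) {l : ℕ → ℕ} (hl : IsPar n l)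
    (h : ∀ k ≤ r, sz k v ≤ sz k l) (hr : sz r v = sz n l) :
    ∃ L, IsCh r (fun _ => 0) l L ∧ HasCt n r v L := by
  induction r generalizing l with
  | zero =>
    have h0 : (fun _ => 0) = l := by
      ext i
      by_cases hi : i < n
      · have h1 : sz n l = 0 := by rw [← hr]; simp [sz]
        exact (Finset.sum_eq_zero_iff.1 h1 i (Finset.mem_range.2 hi)).symm
      · exact (hl.2 i (by omega)).symm
    exact ⟨fun _ => l, ⟨h0.symm, fun _ _ => rfl, fun _ => Hs.refl hl.1⟩, by
      intro k hk
      omega⟩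
  | succ r ih =>
    have hm : v r ≤ l 0 := by
      have h1 := h 1 (by omega)
      simp only [sz, Finset.sum_range_one] at h1
      exact (hv (Nat.zero_le r)).trans h1
    have hs := hs_strip (v r) hl.1
    have hn : sz n l = sz n (strip (v r) l) + v r := by
      rw [sz_strip hm, hl.2 n le_rfl, Nat.min_zero, add_zero]
    have h2 : ∀ k ≤ r, sz k v ≤ sz k (strip (v r) l) := by
      intro k hk
      have h3 := sz_strip hm k
      have h4 := h k (by omega)
      have h5 := h (k + 1) (by omega)
      rw [sz_succ, sz_succ] at h5
      have h6 := hv hk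
      omega
    obtain ⟨L, hL, hc⟩ := ih (hs.isPar hl) h2 (by rw [sz_succ] at hr; omega)
    refine ⟨fun k => if k ≤ r then L k else l, ⟨?_, fun k hk => if_neg (by omega), ?_⟩, ?_⟩
    · simpa using hL.bot
    · intro k
      rcases lt_trichotomy k r with hk | rfl | hk
      · rw [if_pos hk.le, if_pos (by omega)]
        exact hL.hs k
      · rw [if_pos le_rfl, if_neg (by omega), hL.top k le_rfl]
        exact hs
      · rw [if_neg (by omega), if_neg (by omega)]
        exact Hs.refl hl.1
    · intro k hk
      dsimp only
      rcases Nat.lt_succ_iff_lt_or_eq.1 hk with hk | rfl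
      · rw [if_pos hk.le, if_pos (by omega)]
        exact hc k hk
      · rw [if_pos le_rfl, if_neg (by omega), hL.top k le_rfl]
        exact hn

theorem kst_pos {l v : ℕ → ℕ} (hl : l ∈ parts n n) (hv : v ∈ parts n n) (h : Dominates l v) :
    0 < kst n v l := by
  rw [mem_parts] at hl hv
  obtain ⟨L, h1, h2⟩ := exists_isCh hv.1.1 n hl.1 (fun k _ => h k) (hv.2.trans hl.2.symm)
  rw [kst, Finset.card_pos]
  exact ⟨L, mem_filter.2 ⟨(mem_chains hl.1).2 h1, h2⟩⟩

end Kostka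

section Positivity

variable {n : ℕ}

theorem permChar_inv (c : Fin n → ℕ) (g : Perm (Fin n)) :
    permChar n (extc c) g⁻¹ = permChar n (extc c) g := by
  rw [permChar_eq_card, permChar_eq_card]
  congr 1
  refine Nat.card_congr (Equiv.subtypeEquivRight fun F => and_congr_left fun _ => ?_)
  constructor
  · intro h
    conv_lhs => rw [← h, Function.comp_assoc, ← Perm.coe_mul, inv_mul_cancel]
    rfl
  · intro h
    conv_lhs => rw [← h, Function.comp_assoc, ← Perm.coe_mul, mul_inv_cancel]
    rfl

theorem irrChar_inv (a : ℕ → ℕ) (g : Perm (Fin n)) : irrChar n a g⁻¹ = irrChar n a g := by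
  simp only [irrChar_eq, permChar_inv]

theorem isChar_permChar (c : Fin n → ℕ) : IsChar (permChar n (extc c)) := by
  let X := {F : Fin n → Fin n // ∀ i, cnt F i = c i}
  let _ : MulAction (Perm (Fin n)) X :=
    { smul := fun g F => ⟨F.1 ∘ ⇑g⁻¹, by rw [cnt_comp_perm]; exact F.2⟩
      one_smul := fun F => rfl
      mul_smul := fun g h F => Subtype.ext (by
        change F.1 ∘ ⇑(g * h)⁻¹ = (F.1 ∘ ⇑h⁻¹) ∘ ⇑g⁻¹
        rw [mul_inv_rev]
        rfl) }
  have h := isChar_perm (G := Perm (Fin n)) (X := X)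
  convert h using 1
  ext g
  rw [← permChar_inv, permChar_eq_card]
  congr 1
  exact Nat.card_congr ⟨fun F => ⟨⟨F.1, F.2.2⟩, Subtype.ext F.2.1⟩,
    fun F => ⟨F.1.1, congrArg Subtype.val F.2, F.1.2⟩, fun _ => rfl, fun _ => rfl⟩

theorem isChar_irrChar {a : ℕ → ℕ} (ha : a ∈ parts n n) : IsChar (irrChar n a) := by
  set t : Perm (Fin n) → Perm (Fin n) → ℚ := fun σ g =>
    if up n (fun _ => 0) ∘ σ ≤ up n a then
      permChar n (extc (up n a - up n (fun _ => 0) ∘ σ)) g else 0 with ht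
  have h1 : ∀ σ, IsChar (t σ) := by
    intro σ
    by_cases h : up n (fun _ => 0) ∘ σ ≤ up n a
    · simp only [ht, if_pos h]
      exact isChar_permChar _
    · simp only [ht, if_neg h]
      exact isChar_zero
  have h2 : irrChar n a = ∑ σ with Perm.sign σ = 1, t σ - ∑ σ with ¬Perm.sign σ = 1, t σ := by
    ext g
    rw [irrChar_eq, Pi.sub_apply, Finset.sum_apply, Finset.sum_apply,
      ← Finset.sum_filter_add_sum_filter_not univ fun σ : Perm (Fin n) => Perm.sign σ = 1,
      sub_eq_add_neg, ← Finset.sum_neg_distrib]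
    congr 1
    · refine Finset.sum_congr rfl (fun σ hσ => ?_)
      rw [(mem_filter.1 hσ).2]
      simp [ht]
    · refine Finset.sum_congr rfl (fun σ hσ => ?_)
      rw [(Int.units_eq_one_or _).resolve_left (mem_filter.1 hσ).2, Units.val_neg, Units.val_one,
        Int.cast_neg, Int.cast_one, neg_one_mul]
  have ha' := mem_parts.1 ha
  rw [h2]
  refine isChar_of_virtual (IsChar.sum _ _ fun σ _ => h1 σ) (IsChar.sum _ _ fun σ _ => h1 σ)
    (isChar_permChar fun k : Fin n => a k) ?_ ?_
  · rw [← h2, pairing]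
    simp only [irrChar_inv]
    rw [sum_irrChar_mul_irrChar ha ha, if_pos rfl, Nat.card_eq_fintype_card, Fintype.card_perm,
      Fintype.card_fin]
  · rw [← h2, pairing]
    simp only [permChar_inv]
    rw [sum_irrChar_mul_permChar ha'.2, cf_alt_mul_prod_hh_eq_kst a ha'.1, kst_self ha'.1]
    simp [Nat.factorial_pos]

theorem kron_nonneg {a b c : ℕ → ℕ} (ha : a ∈ parts n n) (hb : b ∈ parts n n)
    (hc : c ∈ parts n n) : 0 ≤ kron n a b c := by
  have := ((isChar_irrChar ha).mul (isChar_irrChar hb)).pairing_nonneg (isChar_irrChar hc)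
  rw [pairing] at this
  simp only [irrChar_inv] at this
  exact div_nonneg this (Nat.cast_nonneg _)

end Positivity

section Main

variable {n : ℕ}

theorem pf_eq_zero_iff (P : n.Partition) (i : ℕ) : pf P i = 0 ↔ P.parts.card ≤ i := by
  rw [pf]
  constructor
  · intro h
    by_contra hi
    rw [List.getD_eq_getElem _ _ (by simpa using hi)] at h
    have := List.getElem_mem (l := (P.parts.sort (· ≤ ·)).reverse) (n := i) (by simpa using hi)
    rw [h, List.mem_reverse, Multiset.mem_sort] at this
    exact (P.parts_pos this).ne' rfl
  · intro h
    exact List.getD_eq_default _ _ (by simpa using h)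

theorem card_parts_le (P : n.Partition) : P.parts.card ≤ n := by
  conv_rhs => rw [← P.parts_sum]
  have := Multiset.card_nsmul_le_sum (s := P.parts) (a := 1) (fun x hx => P.parts_pos hx)
  simpa using this

theorem map_range_pf (P : n.Partition) :
    (List.range P.parts.card).map (pf P) = (P.parts.sort (· ≤ ·)).reverse := by
  refine List.ext_getElem (by simp) (fun i h1 h2 => ?_)
  rw [List.getElem_map, List.getElem_range, pf, List.getD_eq_getElem]

theorem pf_mem_parts (P : n.Partition) : pf P ∈ parts n n := by
  rw [mem_parts]
  have hz : ∀ i, P.parts.card ≤ i → pf P i = 0 := fun i => (pf_eq_zero_iff P i).2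
  refine ⟨⟨fun i j hij => ?_, fun i hi => hz i ((card_parts_le P).trans hi)⟩, ?_⟩
  · by_cases hj : j < P.parts.card
    · have hs : ((P.parts.sort (· ≤ ·)).reverse).Pairwise (· ≥ ·) :=
        List.pairwise_reverse.2 (Multiset.pairwise_sort _ _)
      rw [pf, pf, List.getD_eq_getElem _ _ (by simpa using hj),
        List.getD_eq_getElem _ _ (by simpa using hij.trans_lt hj)]
      rcases hij.lt_or_eq with h | rfl
      · exact List.pairwise_iff_getElem.1 hs _ _ _ _ h
      · exact le_rfl
    · rw [hz j (by omega)]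
      exact Nat.zero_le _
  · have h1 : sz P.parts.card (pf P) = n := by
      change ((List.range P.parts.card).map (pf P)).sum = n
      rw [map_range_pf, List.sum_reverse, ← Multiset.sum_coe, Multiset.sort_eq, P.parts_sum]
    refine Eq.trans (Finset.sum_subset ?_ fun i _ hi => hz i ?_).symm h1
    · exact Finset.range_subset_range.2 (card_parts_le P)
    · simpa using hi

theorem pf_injective : Function.Injective (pf : n.Partition → ℕ → ℕ) := by
  intro P Q h
  have hc : P.parts.card = Q.parts.card := by
    refine le_antisymm ?_ ?_
    · rw [← pf_eq_zero_iff, h, pf_eq_zero_iff]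
    · rw [← pf_eq_zero_iff, ← h, pf_eq_zero_iff]
  have h1 := map_range_pf P
  rw [h, hc, map_range_pf, List.reverse_inj] at h1
  ext1
  rw [← Multiset.sort_eq P.parts (· ≤ ·), ← h1, Multiset.sort_eq]

theorem exists_pf {p : ℕ → ℕ} (hp : p ∈ parts n n) : ∃ P : n.Partition, pf P = p := by
  rw [mem_parts] at hp
  obtain ⟨⟨hanti, hsupp⟩, hsum⟩ := hp
  have hex : ∃ i, p i = 0 := ⟨n, hsupp n le_rfl⟩
  set k := Nat.find hex
  have hk0 : ∀ i, k ≤ i → p i = 0 := fun i hi =>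
    Nat.le_zero.1 ((hanti hi).trans (Nat.find_spec hex).le)
  have hkn : k ≤ n := Nat.find_min' hex (hsupp n le_rfl)
  let P : n.Partition :=
    { parts := ((List.range k).map p : List ℕ)
      parts_pos := by
        intro i hi
        obtain ⟨j, hj, rfl⟩ := List.mem_map.1 (Multiset.mem_coe.1 hi)
        exact Nat.pos_of_ne_zero (Nat.find_min hex (List.mem_range.1 hj))
      parts_sum := by
        rw [Multiset.sum_coe]
        refine Eq.trans ?_ hsum
        refine Finset.sum_subset (Finset.range_subset_range.2 hkn) fun i _ hi => hk0 i ?_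
        simpa using hi }
  have hP : (P.parts.sort (· ≤ ·)).reverse = (List.range k).map p := by
    refine List.Perm.eq_of_pairwise (le := (· ≥ ·)) (fun a b _ _ h1 h2 => le_antisymm h2 h1)
      (List.pairwise_reverse.2 (Multiset.pairwise_sort _ _)) ?_ ?_
    · exact List.pairwise_map.2 (List.pairwise_lt_range.imp fun h => hanti h.le)
    · exact (List.reverse_perm _).trans (Multiset.coe_eq_coe.1 (Multiset.sort_eq _ _))
  refine ⟨P, funext fun i => ?_⟩
  rw [pf, hP]
  by_cases hi : i < k
  · rw [List.getD_eq_getElem _ _ (by simpa using hi)]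
    simp
  · rw [List.getD_eq_default _ _ (by simpa using hi), hk0 i (by omega)]

theorem lrNum_eq_lrn (α β ν : n.Partition) :
    lrNum n (pf α) (pf β) (pfin ν) = lrn n (pf ν) n (pf α) (pf β) :=
  (lrPairs_card (pf ν) n (mem_parts.1 (pf_mem_parts α)).1 (mem_parts.1 (pf_mem_parts β)).1).2

end Main

end

end

end KroneckerLR

/-- `χ^ν` is a maximal component of `χ^α ⊗ χ^β` iff
`k(α,β,ν) = lr(α,β;ν)`. -/
theorem stmt12 (n : ℕ) (α β ν : n.Partition) (h : 0 < kron n (pf α) (pf β) (pf ν)) :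
    (∀ γ : n.Partition, Dominates (pf γ) (pf ν) → γ ≠ ν →
        kron n (pf α) (pf β) (pf γ) = 0) ↔
      kron n (pf α) (pf β) (pf ν) = (lrNum n (pf α) (pf β) (pfin ν) : ℚ) := by
  open KroneckerLR in
  have hα := pf_mem_parts α
  have hβ := pf_mem_parts β
  have hν := pf_mem_parts ν
  have hnn : ∀ p ∈ (parts n n).erase (pf ν), 0 ≤ (kst n (pf ν) p : ℚ) * kron n (pf α) (pf β) p :=
    fun p hp => mul_nonneg (Nat.cast_nonneg _) (kron_nonneg hα hβ (Finset.mem_of_mem_erase hp))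
  rw [lrNum_eq_lrn, lrn_eq_sum hα hβ hν, ← Finset.add_sum_erase _ _ hν,
    kst_self (mem_parts.1 hν).1, Nat.cast_one, one_mul, left_eq_add,
    Finset.sum_eq_zero_iff_of_nonneg hnn]
  constructor
  · intro H p hp
    obtain ⟨hne, hp⟩ := Finset.mem_erase.1 hp
    obtain ⟨γ, rfl⟩ := exists_pf hp
    by_cases hk : kst n (pf ν) (pf γ) = 0
    · rw [hk, Nat.cast_zero, zero_mul]
    · rw [H γ (dominates_of_kst_ne_zero (mem_parts.1 hp).1 (mem_parts.1 hν).1 hk)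
        (fun h => hne (congrArg pf h)), mul_zero]
  · intro H γ hd hne
    have hγ := pf_mem_parts γ
    refine (mul_eq_zero.1 (H (pf γ) (Finset.mem_erase.2 ⟨pf_injective.ne hne, hγ⟩))).resolve_left ?_
    exact Nat.cast_ne_zero.2 (kst_pos hγ hν hd).ne'
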